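/- arXiv:1007.0270 — 2 statements merged into one kernel-verified Lean document; each statement's English description precedes it below -/
import Mathlib

section
/- For every c > 0 there is C > 0 such that for all u, z : ℤ → [0,∞) with ‖u‖_{ℓ²}, ‖z‖_{ℓ²} < ∞: the sum of M₂ · u(j₁) u(j₂) u(j₃) u(k₂) u(k₃) z(k) over all integer tuples with k = k₁+k₂+k₃, k₁ = j₁+j₂+j₃, Φ(k̄) ≠ 0, and max(|j₁|,|j₂|,|j₃|) ≥ c · min(|k|,|k₁|)^{101/100}, is at most C ‖u‖⁵_{ℓ²} ‖z‖_{ℓ²}, where M₂ := |k| ⟨k⟩^{1/2} ⟨k₁⟩ / (|Φ(k̄)| ⟨j₁⟩^{1/2} ⟨j₂⟩^{1/2} ⟨j₃⟩^{1/2} ⟨k₂⟩^{1/2} ⟨k₃⟩^{1/2}). -/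
open scoped ENNReal

/-- Japanese bracket `⟨k⟩ = 1 + |k|`. -/
noncomputable def jb (k : ℤ) : ℝ := 1 + |(k : ℝ)|

/-- `‖u‖_{ℓ²} = (∑_k u(k)²)^{1/2}`, valued in `[0,∞]`. -/
noncomputable def l2 (u : ℤ → ℝ) : ℝ≥0∞ :=
  (∑' k : ℤ, ENNReal.ofReal (u k ^ 2)) ^ (1 / 2 : ℝ)

/-- `Φ(k̄) = k³ − k₁³ − k₂³ − k₃³` with `k = k₁ + k₂ + k₃`. -/
def Phi (k₁ k₂ k₃ : ℤ) : ℤ := (k₁ + k₂ + k₃) ^ 3 - k₁ ^ 3 - k₂ ^ 3 - k₃ ^ 3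

/-- The multiplier `M₂ = |k| ⟨k⟩^s ⟨k₁⟩ / (|Φ(k̄)| ⟨j₁⟩^s ⟨j₂⟩^s ⟨j₃⟩^s ⟨k₂⟩^s ⟨k₃⟩^s)`,
where `k₁ = j₁ + j₂ + j₃` and `k = k₁ + k₂ + k₃`. -/
noncomputable def M2 (s : ℝ) (j₁ j₂ j₃ k₂ k₃ : ℤ) : ℝ :=
  |((j₁ + j₂ + j₃ + k₂ + k₃ : ℤ) : ℝ)| * jb (j₁ + j₂ + j₃ + k₂ + k₃) ^ s *
    jb (j₁ + j₂ + j₃) /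
    (|((Phi (j₁ + j₂ + j₃) k₂ k₃ : ℤ) : ℝ)| *
      jb j₁ ^ s * jb j₂ ^ s * jb j₃ ^ s * jb k₂ ^ s * jb k₃ ^ s)

/-- `k* = max(|k₁|,|k₂|,|k₃|)`. -/
def kstar (k₁ k₂ k₃ : ℤ) : ℤ := max (max |k₁| |k₂|) |k₃|

/-- `λ_k = min(|k₁+k₂|,|k₂+k₃|,|k₃+k₁|)`. -/
def lam (k₁ k₂ k₃ : ℤ) : ℤ := min (min |k₁ + k₂| |k₂ + k₃|) |k₃ + k₁|

/-- `Λ_k = min(|k₁+k₂||k₂+k₃|, |k₂+k₃||k₃+k₁|, |k₃+k₁||k₁+k₂|)`. -/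
def Lam (k₁ k₂ k₃ : ℤ) : ℤ :=
  min (min (|k₁ + k₂| * |k₂ + k₃|) (|k₂ + k₃| * |k₃ + k₁|)) (|k₃ + k₁| * |k₁ + k₂|)

open Classical in
/-- Summand for the restricted `M₂` estimate: case (c), where
`max(|j₁|,|j₂|,|j₃|) ≳ min(|k|,|k₁|)^{101/100}`. -/
noncomputable def term17 (c : ℝ) (u z : ℤ → ℝ) (j₁ j₂ j₃ k₂ k₃ : ℤ) : ℝ :=
  let k₁ := j₁ + j₂ + j₃
  let k := k₁ + k₂ + k₃
  if Phi k₁ k₂ k₃ ≠ 0 ∧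
      c * ((min |k| |k₁| : ℤ) : ℝ) ^ (101 / 100 : ℝ) ≤
        ((max (max |j₁| |j₂|) |j₃| : ℤ) : ℝ) then
    M2 (1 / 2) j₁ j₂ j₃ k₂ k₃ * (u j₁ * u j₂ * u j₃ * u k₂ * u k₃ * z k)
  else 0

/-! ### Brackets -/

theorem one_le_jb (k : ℤ) : 1 ≤ jb k := by
  unfold jb; linarith [abs_nonneg (k : ℝ)]

theorem jb_pos (k : ℤ) : 0 < jb k := zero_lt_one.trans_le (one_le_jb k)

theorem jb_le_jb {k l : ℤ} (h : |k| ≤ |l|) : jb k ≤ jb l := by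
  have : |(k : ℝ)| ≤ |(l : ℝ)| := by exact_mod_cast h
  unfold jb; linarith

theorem jb_neg (k : ℤ) : jb (-k) = jb k := by simp [jb]

/-- The power weight `⟨k⟩^s` as an extended nonnegative real. -/
noncomputable def jbw (s : ℝ) (k : ℤ) : ℝ≥0∞ := ENNReal.ofReal (jb k ^ s)

theorem jbw_neg (s : ℝ) (k : ℤ) : jbw s (-k) = jbw s k := by simp [jbw, jb_neg]

theorem jbw_mul (s t : ℝ) (k : ℤ) : jbw s k * jbw t k = jbw (s + t) k := by
  rw [jbw, jbw, jbw, ← ENNReal.ofReal_mul (Real.rpow_nonneg (jb_pos k).le _),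
    Real.rpow_add (jb_pos k)]

theorem jbw_sq (s : ℝ) (k : ℤ) : jbw s k ^ 2 = jbw (2 * s) k := by
  rw [sq, jbw_mul, two_mul]

theorem tsum_jbw_lt_top {s : ℝ} (hs : s < -1) : ∑' k : ℤ, jbw s k < ⊤ := by
  have hsum : Summable fun k : ℤ => jb k ^ s := by
    have h1 : Summable fun n : ℕ => ((n : ℝ) + 1) ^ s := by
      have := (summable_nat_add_iff 1).2 (Real.summable_nat_rpow.2 hs)
      simpa using this
    refine Summable.of_nat_of_neg ?_ ?_ <;>
    · refine h1.congr fun n => ?_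
      simp [jb, add_comm]
  simp only [jbw]
  rw [← ENNReal.ofReal_tsum_of_nonneg (fun k => Real.rpow_nonneg (jb_pos k).le _) hsum]
  exact ENNReal.ofReal_lt_top

/-- A product of two negative powers is dominated by the sum of the powers of the total order. -/
theorem jbw_mul_le_add {s t : ℝ} (hs : s ≤ 0) (ht : t ≤ 0) (x y : ℤ) :
    jbw s x * jbw t y ≤ jbw (s + t) x + jbw (s + t) y := by
  rcases le_total (jb x) (jb y) with h | h
  · rw [← jbw_mul s t x]
    refine le_add_right (mul_le_mul_right (ENNReal.ofReal_le_ofReal ?_) _)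
    exact Real.rpow_le_rpow_of_nonpos (jb_pos x) h ht
  · rw [← jbw_mul s t y]
    refine le_add_left (mul_le_mul_left (ENNReal.ofReal_le_ofReal ?_) _)
    exact Real.rpow_le_rpow_of_nonpos (jb_pos y) h hs

/-! ### Cauchy–Schwarz and convolution-type sums -/

/-- The `ℓ²` norm of an extended nonnegative function. -/
noncomputable def eL2 {ι : Type*} (f : ι → ℝ≥0∞) : ℝ≥0∞ := (∑' i, f i ^ 2) ^ (1 / 2 : ℝ)

theorem tsum_mul_le_eL2 {ι : Type*} (f g : ι → ℝ≥0∞) :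
    ∑' i, f i * g i ≤ eL2 f * eL2 g := by
  let _ : MeasurableSpace ι := ⊤
  have h := ENNReal.lintegral_mul_le_Lp_mul_Lq (MeasureTheory.Measure.count (α := ι))
    Real.HolderConjugate.two_two
    (measurable_from_top (f := f)).aemeasurable (measurable_from_top (f := g)).aemeasurable
  simpa [MeasureTheory.lintegral_count, eL2] using h

theorem l2_eq_eL2 {u : ℤ → ℝ} (hu : ∀ k, 0 ≤ u k) :
    l2 u = eL2 fun k => ENNReal.ofReal (u k) := by
  simp only [l2, eL2]
  congr 2
  ext k
  rw [ENNReal.ofReal_pow (hu k)]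

theorem eL2_comp_equiv {ι κ : Type*} (e : ι ≃ κ) (f : κ → ℝ≥0∞) :
    eL2 (fun i => f (e i)) = eL2 f := by
  simp only [eL2]
  rw [e.tsum_eq (fun i => f i ^ 2)]

theorem mul_mul_rpow_half_sq (a b S : ℝ≥0∞) (T : ℝ≥0∞) :
    (a * S) ^ (1 / 2 : ℝ) * (b * T) ^ (1 / 2 : ℝ) =
      (S * T) ^ (1 / 2 : ℝ) * (a ^ (1 / 2 : ℝ) * b ^ (1 / 2 : ℝ)) := by
  simp only [ENNReal.mul_rpow_of_nonneg _ _ (show (0 : ℝ) ≤ 1 / 2 by norm_num)]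
  ring

/-- The constant in the bilinear estimate `tsum_bilinear_le`. -/
noncomputable def bilinearConst (δ : ℝ) : ℝ≥0∞ :=
  ((∑' k, jbw (-1 - δ) k) * (2 * ∑' k, jbw (-1 - δ) k)) ^ (1 / 2 : ℝ)

theorem bilinearConst_lt_top {δ : ℝ} (hδ : 0 < δ) : bilinearConst δ < ⊤ := by
  have h := tsum_jbw_lt_top (s := -1 - δ) (by linarith)
  exact ENNReal.rpow_lt_top_of_nonneg (by norm_num)
    (ENNReal.mul_lt_top h (ENNReal.mul_lt_top (by simp) h)).ne

theorem tsum_bilinear_le {δ : ℝ} (hδ : 0 < δ) (hδ1 : δ ≤ 1) (A B : ℤ → ℝ≥0∞) :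
    ∑' p : ℤ × ℤ, A p.1 * B p.2 * (jbw (-δ) p.1 * jbw (-1) (p.1 + p.2)) ≤
      bilinearConst δ * (eL2 A * eL2 B) := by
  set S := ∑' k, jbw (-1 - δ) k with hS
  have hsplit : ∀ p : ℤ × ℤ, A p.1 * B p.2 * (jbw (-δ) p.1 * jbw (-1) (p.1 + p.2)) =
      (A p.1 * jbw ((-1 - δ) / 2) (p.1 + p.2)) *
        (B p.2 * (jbw (-δ) p.1 * jbw ((-1 + δ) / 2) (p.1 + p.2))) := by
    intro p
    rw [show (-1 : ℝ) = (-1 - δ) / 2 + (-1 + δ) / 2 by ring, ← jbw_mul]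
    ring_nf
  have hA : ∑' p : ℤ × ℤ, (A p.1 * jbw ((-1 - δ) / 2) (p.1 + p.2)) ^ 2 =
      (∑' x, A x ^ 2) * S := by
    simp only [mul_pow, jbw_sq]
    rw [ENNReal.tsum_prod', ← ENNReal.tsum_mul_right]
    refine tsum_congr fun x => ?_
    dsimp only
    rw [ENNReal.tsum_mul_left]
    congr 1
    rw [hS, ← (Equiv.addLeft x).tsum_eq (jbw (-1 - δ))]
    refine tsum_congr fun y => ?_
    simp only [Equiv.coe_addLeft]
    congr 1
    ring
  have hB : ∑' p : ℤ × ℤ, (B p.2 * (jbw (-δ) p.1 * jbw ((-1 + δ) / 2) (p.1 + p.2))) ^ 2 ≤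
      (∑' y, B y ^ 2) * (2 * S) := by
    simp only [mul_pow, jbw_sq]
    rw [ENNReal.tsum_prod', ENNReal.tsum_comm, ← ENNReal.tsum_mul_right]
    refine ENNReal.tsum_le_tsum fun y => ?_
    dsimp only
    rw [ENNReal.tsum_mul_left]
    refine mul_le_mul_right ?_ _
    calc ∑' x, jbw (2 * -δ) x * jbw (2 * ((-1 + δ) / 2)) (x + y)
        ≤ ∑' x, (jbw (-1 - δ) x + jbw (-1 - δ) (x + y)) := by
          refine ENNReal.tsum_le_tsum fun x => ?_
          have := jbw_mul_le_add (s := 2 * -δ) (t := 2 * ((-1 + δ) / 2))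
            (by linarith) (by linarith) x (x + y)
          rwa [show 2 * -δ + 2 * ((-1 + δ) / 2) = -1 - δ by ring] at this
      _ = 2 * S := by
          rw [ENNReal.tsum_add, two_mul, ← hS]
          congr 1
          exact (Equiv.addRight y).tsum_eq (jbw (-1 - δ))
  simp only [hsplit]
  refine (tsum_mul_le_eL2 _ _).trans ?_
  rw [bilinearConst, ← hS]
  unfold eL2
  rw [← mul_mul_rpow_half_sq, hA]
  exact mul_le_mul_right (ENNReal.rpow_le_rpow hB (by norm_num)) _

theorem tsum_quadrilinear_le {δ : ℝ} (hδ : 0 < δ) (hδ1 : δ ≤ 1) (A B D E : ℤ → ℝ≥0∞) :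
    ∑' p : ℤ × ℤ × ℤ, A p.1 * B p.2.1 * D p.2.2 * E (-(p.1 + p.2.1 + p.2.2)) *
        (jbw (-δ) p.1 * jbw (-1) (p.1 + p.2.1)) ≤
      bilinearConst δ * (eL2 A * eL2 B * eL2 D * eL2 E) := by
  have hinner : ∀ s : ℤ, ∑' t, D t * E (-(s + t)) ≤ eL2 D * eL2 E := fun s => by
    refine (tsum_mul_le_eL2 _ _).trans_eq ?_
    rw [← eL2_comp_equiv ((Equiv.addLeft s).trans (Equiv.neg ℤ)) E]
    rfl
  rw [← (Equiv.prodAssoc ℤ ℤ ℤ).tsum_eq, ENNReal.tsum_prod']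
  calc _ ≤ ∑' p : ℤ × ℤ, A p.1 * B p.2 * (jbw (-δ) p.1 * jbw (-1) (p.1 + p.2)) *
        (eL2 D * eL2 E) := by
        refine ENNReal.tsum_le_tsum fun p => ?_
        refine le_trans (le_of_eq ?_) (mul_le_mul_right (hinner (p.1 + p.2)) _)
        rw [← ENNReal.tsum_mul_left]
        refine tsum_congr fun t => ?_
        simp only [Equiv.prodAssoc_apply]
        ring
    _ ≤ _ := by
        rw [ENNReal.tsum_mul_right]
        refine (mul_le_mul_left (tsum_bilinear_le hδ hδ1 A B) _).trans_eq ?_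
        ring

/-- The weight `(⟨k₁⟩^{-δ} + ⟨k⟩^{-δ}) (⟨k₂+k₃⟩⁻¹ + ⟨k₁+k₃⟩⁻¹ + ⟨k₁+k₂⟩⁻¹)`. -/
noncomputable def resWeight (δ : ℝ) (k₁ k₂ k₃ : ℤ) : ℝ≥0∞ :=
  (jbw (-δ) k₁ + jbw (-δ) (k₁ + k₂ + k₃)) *
    (jbw (-1) (k₂ + k₃) + jbw (-1) (k₁ + k₃) + jbw (-1) (k₁ + k₂))

theorem tsum_resWeight_le {δ : ℝ} (hδ : 0 < δ) (hδ1 : δ ≤ 1) (F G H Z : ℤ → ℝ≥0∞) :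
    ∑' p : ℤ × ℤ × ℤ, F p.1 * G p.2.1 * H p.2.2 * Z (p.1 + p.2.1 + p.2.2) *
        resWeight δ p.1 p.2.1 p.2.2 ≤
      6 * bilinearConst δ * (eL2 F * eL2 G * eL2 H * eL2 Z) := by
  set Y : ℤ → ℝ≥0∞ := fun a => Z (-a) with hY
  have hYZ : eL2 Y = eL2 Z := eL2_comp_equiv (Equiv.neg ℤ) Z
  have key : ∀ (A B D E : ℤ → ℝ≥0∞) (φ : ℤ × ℤ × ℤ → ℤ × ℤ × ℤ), Function.Injective φ →
      ∑' p, (fun p : ℤ × ℤ × ℤ => A p.1 * B p.2.1 * D p.2.2 * E (-(p.1 + p.2.1 + p.2.2)) *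
        (jbw (-δ) p.1 * jbw (-1) (p.1 + p.2.1))) (φ p) ≤
      bilinearConst δ * (eL2 A * eL2 B * eL2 D * eL2 E) := fun A B D E φ hφ =>
    (ENNReal.tsum_comp_le_tsum_of_injective hφ _).trans (tsum_quadrilinear_le hδ hδ1 A B D E)
  have h1 := key F G H Y (fun p => (p.1, p.2.1, p.2.2))
    (fun p q h => by simp only [Prod.mk.injEq] at h; ext <;> omega)
  have h2 := key F H G Y (fun p => (p.1, p.2.2, p.2.1))
    (fun p q h => by simp only [Prod.mk.injEq] at h; ext <;> omega)
  have h3 := key F Y G H (fun p => (p.1, -(p.1 + p.2.1 + p.2.2), p.2.1))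
    (fun p q h => by simp only [Prod.mk.injEq] at h; ext <;> omega)
  have h4 := key Y F G H (fun p => (-(p.1 + p.2.1 + p.2.2), p.1, p.2.1))
    (fun p q h => by simp only [Prod.mk.injEq] at h; ext <;> omega)
  have h5 := key Y G F H (fun p => (-(p.1 + p.2.1 + p.2.2), p.2.1, p.1))
    (fun p q h => by simp only [Prod.mk.injEq] at h; ext <;> omega)
  have h6 := key Y H F G (fun p => (-(p.1 + p.2.1 + p.2.2), p.2.2, p.1))
    (fun p q h => by simp only [Prod.mk.injEq] at h; ext <;> omega)
  have hsum := add_le_add (add_le_add (add_le_add (add_le_add (add_le_add h1 h2) h3) h4) h5) h6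
  simp only [← ENNReal.tsum_add, hYZ] at hsum
  refine le_trans (le_of_eq (tsum_congr fun p => ?_)) (hsum.trans_eq (by ring))
  obtain ⟨a, b, c⟩ := p
  simp only [hY, resWeight]
  have e1 : -(a + -(a + b + c) + b) = c := by ring
  have e2 : -(-(a + b + c) + a + b) = c := by ring
  have e3 : -(-(a + b + c) + b + a) = c := by ring
  have e4 : -(-(a + b + c) + c + a) = b := by ring
  have e5 : a + -(a + b + c) = -(b + c) := by ring
  have e6 : -(a + b + c) + a = -(b + c) := by ring
  have e7 : -(a + b + c) + b = -(a + c) := by ring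
  have e8 : -(a + b + c) + c = -(a + b) := by ring
  have e9 : a + c + b = a + b + c := by ring
  simp only [e1, e2, e3, e4]
  simp only [e5, e6, e7, e8, e9, jbw_neg, neg_neg]
  ring

/-! ### Pointwise bound of the multiplier -/

theorem Phi_eq (k₁ k₂ k₃ : ℤ) :
    Phi k₁ k₂ k₃ = 3 * (k₂ + k₃) * (k₁ + k₃) * (k₁ + k₂) := by
  unfold Phi; ring

theorem jb_le_two_mul_abs {x : ℤ} (hx : x ≠ 0) : jb x ≤ 2 * |(x : ℝ)| := by
  have : (1 : ℝ) ≤ |(x : ℝ)| := by exact_mod_cast Int.one_le_abs hx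
  unfold jb; linarith

theorem jb_add_le {x y : ℤ} (hy : y ≠ 0) : jb (x + y) ≤ 2 * jb x * |(y : ℝ)| := by
  have h1 : (1 : ℝ) ≤ |(y : ℝ)| := by exact_mod_cast Int.one_le_abs hy
  have h2 : |((x + y : ℤ) : ℝ)| ≤ |(x : ℝ)| + |(y : ℝ)| := by push_cast; exact abs_add_le _ _
  unfold jb
  nlinarith [abs_nonneg (x : ℝ)]

/-- The resonance function controls the largest frequencies, up to the pair product. -/
theorem jb_prod_le_sq {k₁ k₂ k₃ : ℤ} (ha : k₂ + k₃ ≠ 0) (hb : k₁ + k₃ ≠ 0) (hc : k₁ + k₂ ≠ 0) :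
    ∃ P : ℝ, 0 ≤ P ∧
      P ≤ |((k₁ + k₃ : ℤ) : ℝ)| * |((k₁ + k₂ : ℤ) : ℝ)| +
        |((k₂ + k₃ : ℤ) : ℝ)| * |((k₁ + k₂ : ℤ) : ℝ)| +
        |((k₂ + k₃ : ℤ) : ℝ)| * |((k₁ + k₃ : ℤ) : ℝ)| ∧
      jb (k₁ + k₂ + k₃) ^ 3 * jb k₁ ^ 2 ≤
        36 * min (jb (k₁ + k₂ + k₃)) (jb k₁) * jb k₂ * jb k₃ * P ^ 2 := by
  set k := k₁ + k₂ + k₃ with hk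
  have hK1a : jb k₁ ≤ 2 * jb k₂ * |((k₁ + k₂ : ℤ) : ℝ)| := by
    have := jb_add_le (x := -k₂) hc
    rwa [jb_neg, show -k₂ + (k₁ + k₂) = k₁ by ring] at this
  have hK1b : jb k₁ ≤ 2 * jb k₃ * |((k₁ + k₃ : ℤ) : ℝ)| := by
    have := jb_add_le (x := -k₃) hb
    rwa [jb_neg, show -k₃ + (k₁ + k₃) = k₁ by ring] at this
  have hKa : jb k ≤ 2 * jb k₃ * |((k₁ + k₂ : ℤ) : ℝ)| := by
    have := jb_add_le (x := k₃) hc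
    rwa [show k₃ + (k₁ + k₂) = k by rw [hk]; ring] at this
  have hKb : jb k ≤ 2 * jb k₂ * |((k₁ + k₃ : ℤ) : ℝ)| := by
    have := jb_add_le (x := k₂) hb
    rwa [show k₂ + (k₁ + k₃) = k by rw [hk]; ring] at this
  have h1 : (1 : ℝ) ≤ |((k₂ + k₃ : ℤ) : ℝ)| := by exact_mod_cast Int.one_le_abs ha
  have h2 : (1 : ℝ) ≤ |((k₁ + k₃ : ℤ) : ℝ)| := by exact_mod_cast Int.one_le_abs hb
  have h3 : (1 : ℝ) ≤ |((k₁ + k₂ : ℤ) : ℝ)| := by exact_mod_cast Int.one_le_abs hc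
  have hsumK : 2 * |(k : ℝ)| ≤ |((k₂ + k₃ : ℤ) : ℝ)| + |((k₁ + k₃ : ℤ) : ℝ)| +
      |((k₁ + k₂ : ℤ) : ℝ)| := by
    have : 2 * |k| ≤ |k₂ + k₃| + |k₁ + k₃| + |k₁ + k₂| := by
      simp only [abs_eq_max_neg]; omega
    exact_mod_cast this
  have hsumK1 : 2 * |(k₁ : ℝ)| ≤ |((k₂ + k₃ : ℤ) : ℝ)| + |((k₁ + k₃ : ℤ) : ℝ)| +
      |((k₁ + k₂ : ℤ) : ℝ)| := by
    have : 2 * |k₁| ≤ |k₂ + k₃| + |k₁ + k₃| + |k₁ + k₂| := by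
      simp only [abs_eq_max_neg]; omega
    exact_mod_cast this
  have hK := one_le_jb k
  have hK1 := one_le_jb k₁
  have hK2 := one_le_jb k₂
  have hK3 := one_le_jb k₃
  have hKd : jb k = 1 + |(k : ℝ)| := rfl
  have hK1d : jb k₁ = 1 + |(k₁ : ℝ)| := rfl
  generalize |((k₂ + k₃ : ℤ) : ℝ)| = D₁ at *
  generalize |((k₁ + k₃ : ℤ) : ℝ)| = D₂ at *
  generalize |((k₁ + k₂ : ℤ) : ℝ)| = D₃ at *
  have core : ∀ E X : ℝ, 0 ≤ E → 0 ≤ X → jb k * jb k₁ ≤ 4 * (jb k₂ * jb k₃) * E ^ 2 →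
      jb k ≤ 3 * X → jb k₁ ≤ 3 * X →
      jb k ^ 3 * jb k₁ ^ 2 ≤ 36 * min (jb k) (jb k₁) * jb k₂ * jb k₃ * (E * X) ^ 2 := by
    intro E X hE hX h4 hkX hk1X
    have hm : jb k * jb k₁ = min (jb k) (jb k₁) * max (jb k) (jb k₁) := (min_mul_max _ _).symm
    have hmax : max (jb k) (jb k₁) ≤ 3 * X := max_le hkX hk1X
    have hmin : 0 ≤ min (jb k) (jb k₁) := le_min (by linarith) (by linarith)
    have hKX : jb k * max (jb k) (jb k₁) ≤ (3 * X) * (3 * X) :=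
      mul_le_mul hkX hmax (le_max_of_le_left (by linarith)) (by linarith)
    have h5 : (jb k * jb k₁) * (jb k * max (jb k) (jb k₁)) ≤
        (4 * (jb k₂ * jb k₃) * E ^ 2) * ((3 * X) * (3 * X)) :=
      mul_le_mul h4 hKX (mul_nonneg (by linarith) (le_max_of_le_left (by linarith)))
        (by positivity)
    calc jb k ^ 3 * jb k₁ ^ 2 = (jb k * jb k₁) * (jb k * (jb k * jb k₁)) := by ring
      _ = min (jb k) (jb k₁) * ((jb k * jb k₁) * (jb k * max (jb k) (jb k₁))) := by
        nth_rewrite 2 [hm]; ring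
      _ ≤ min (jb k) (jb k₁) * ((4 * (jb k₂ * jb k₃) * E ^ 2) * ((3 * X) * (3 * X))) :=
        mul_le_mul_of_nonneg_left h5 hmin
      _ = _ := by ring
  have hE3 : jb k * jb k₁ ≤ 4 * (jb k₂ * jb k₃) * D₃ ^ 2 := by
    have := mul_le_mul hKa hK1a (by linarith) (by positivity)
    nlinarith
  have hE2 : jb k * jb k₁ ≤ 4 * (jb k₂ * jb k₃) * D₂ ^ 2 := by
    have := mul_le_mul hKb hK1b (by linarith) (by positivity)
    nlinarith
  have p12 : 0 ≤ D₁ * D₂ := by positivity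
  have p13 : 0 ≤ D₁ * D₃ := by positivity
  have p23 : 0 ≤ D₂ * D₃ := by positivity
  by_cases c1 : D₂ ≤ D₁ ∧ D₃ ≤ D₁
  · exact ⟨D₃ * D₁, by positivity, by linarith,
      core D₃ D₁ (by linarith) (by linarith) hE3 (by linarith) (by linarith)⟩
  by_cases c2 : D₁ ≤ D₂ ∧ D₃ ≤ D₂
  · exact ⟨D₃ * D₂, by positivity, by linarith,
      core D₃ D₂ (by linarith) (by linarith) hE3 (by linarith) (by linarith)⟩
  have c3 : D₁ ≤ D₃ ∧ D₂ ≤ D₃ := by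
    rcases le_total D₁ D₂ with h | h <;> rcases le_total D₂ D₃ with h' | h' <;>
      rcases le_total D₁ D₃ with h'' | h'' <;>
      first
      | exact ⟨by linarith, by linarith⟩
      | exact absurd ⟨by linarith, by linarith⟩ c1
      | exact absurd ⟨by linarith, by linarith⟩ c2
  exact ⟨D₂ * D₃, by positivity, by linarith,
    core D₂ D₃ (by linarith) (by linarith) hE2 (by linarith) (by linarith)⟩

theorem sqrt_mul_rpow_le {c M a b d : ℝ} (hM : 1 ≤ M) (ha : 1 ≤ a) (hb : 1 ≤ b) (hd : 1 ≤ d)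
    (hba : b ≤ a) (hda : d ≤ a) (hc : 1 ≤ c) (h : M ^ (101 / 100 : ℝ) ≤ c * a) :
    M ^ (1 / 2 : ℝ) / (a ^ (1 / 2 : ℝ) * b ^ (1 / 2 : ℝ) * d ^ (1 / 2 : ℝ)) ≤
      c * (M ^ (-(1 / 1000) : ℝ) * (b ^ (-(501 / 1000) : ℝ) * d ^ (-(501 / 1000) : ℝ))) := by
  have hM0 : 0 < M := by linarith
  have ha0 : 0 < a := by linarith
  have hb0 : 0 < b := by linarith
  have hd0 : 0 < d := by linarith
  have hc0 : 0 < c := by linarith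
  have h1 : M ^ (501 / 1000 : ℝ) ≤ c * a ^ (498 / 1000 : ℝ) := by
    calc M ^ (501 / 1000 : ℝ) ≤ M ^ ((101 / 100 : ℝ) * (498 / 1000)) :=
          Real.rpow_le_rpow_of_exponent_le hM (by norm_num)
      _ = (M ^ (101 / 100 : ℝ)) ^ (498 / 1000 : ℝ) := Real.rpow_mul hM0.le _ _
      _ ≤ (c * a) ^ (498 / 1000 : ℝ) := Real.rpow_le_rpow (by positivity) h (by norm_num)
      _ = c ^ (498 / 1000 : ℝ) * a ^ (498 / 1000 : ℝ) := Real.mul_rpow hc0.le ha0.le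
      _ ≤ c * a ^ (498 / 1000 : ℝ) := by
          gcongr
          simpa using Real.rpow_le_rpow_of_exponent_le hc
            (show (498 / 1000 : ℝ) ≤ 1 by norm_num)
  have h2 : b ^ (1 / 1000 : ℝ) * d ^ (1 / 1000 : ℝ) ≤ a ^ (2 / 1000 : ℝ) := by
    calc _ ≤ a ^ (1 / 1000 : ℝ) * a ^ (1 / 1000 : ℝ) := by gcongr
      _ = _ := by rw [← Real.rpow_add ha0]; norm_num
  have ea : a ^ (1 / 2 : ℝ) = a ^ (498 / 1000 : ℝ) * a ^ (2 / 1000 : ℝ) := by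
    rw [← Real.rpow_add ha0]; norm_num
  have eM : M ^ (1 / 2 : ℝ) = M ^ (501 / 1000 : ℝ) * M ^ (-(1 / 1000) : ℝ) := by
    rw [← Real.rpow_add hM0]; norm_num
  have eb : b ^ (-(501 / 1000) : ℝ) * b ^ (1 / 2 : ℝ) * b ^ (1 / 1000 : ℝ) = 1 := by
    rw [← Real.rpow_add hb0, ← Real.rpow_add hb0]; norm_num
  have ed : d ^ (-(501 / 1000) : ℝ) * d ^ (1 / 2 : ℝ) * d ^ (1 / 1000 : ℝ) = 1 := by
    rw [← Real.rpow_add hd0, ← Real.rpow_add hd0]; norm_num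
  rw [div_le_iff₀ (by positivity)]
  calc M ^ (1 / 2 : ℝ) = M ^ (501 / 1000 : ℝ) * M ^ (-(1 / 1000) : ℝ) := eM
    _ ≤ c * a ^ (498 / 1000 : ℝ) * M ^ (-(1 / 1000) : ℝ) := by gcongr
    _ = c * M ^ (-(1 / 1000) : ℝ) * a ^ (498 / 1000 : ℝ) *
        ((b ^ (-(501 / 1000) : ℝ) * b ^ (1 / 2 : ℝ) * b ^ (1 / 1000 : ℝ)) *
        (d ^ (-(501 / 1000) : ℝ) * d ^ (1 / 2 : ℝ) * d ^ (1 / 1000 : ℝ))) := by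
        rw [eb, ed]; ring
    _ = c * M ^ (-(1 / 1000) : ℝ) * a ^ (498 / 1000 : ℝ) *
        (b ^ (-(501 / 1000) : ℝ) * b ^ (1 / 2 : ℝ)) *
        (d ^ (-(501 / 1000) : ℝ) * d ^ (1 / 2 : ℝ)) *
        (b ^ (1 / 1000 : ℝ) * d ^ (1 / 1000 : ℝ)) := by ring
    _ ≤ c * M ^ (-(1 / 1000) : ℝ) * a ^ (498 / 1000 : ℝ) *
        (b ^ (-(501 / 1000) : ℝ) * b ^ (1 / 2 : ℝ)) *
        (d ^ (-(501 / 1000) : ℝ) * d ^ (1 / 2 : ℝ)) * a ^ (2 / 1000 : ℝ) := by gcongr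
    _ = _ := by rw [ea]; ring

theorem min_jb_rpow_le {c : ℝ} (hc : 0 < c) {k l J : ℤ}
    (h : c * ((min |k| |l| : ℤ) : ℝ) ^ (101 / 100 : ℝ) ≤ (|J| : ℤ)) :
    (min (jb k) (jb l)) ^ (101 / 100 : ℝ) ≤ 4 * (1 + 1 / c) * jb J := by
  have hm : min (jb k) (jb l) = 1 + ((min |k| |l| : ℤ) : ℝ) := by
    unfold jb; push_cast; rw [min_add_add_left]
  have hJ : jb J = 1 + ((|J| : ℤ) : ℝ) := by unfold jb; push_cast; rfl
  rw [hm, hJ]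
  have hn : (0 : ℤ) ≤ min |k| |l| := le_min (abs_nonneg _) (abs_nonneg _)
  have hJ0 : (0 : ℝ) ≤ ((|J| : ℤ) : ℝ) := by exact_mod_cast abs_nonneg J
  generalize ((|J| : ℤ) : ℝ) = y at *
  have hc' : 0 < 1 / c := by positivity
  rcases hn.eq_or_lt with h0 | h0
  · rw [← h0]
    norm_num
    rw [← one_div]
    nlinarith [mul_nonneg hc'.le hJ0]
  · have h1 : (1 : ℝ) ≤ ((min |k| |l| : ℤ) : ℝ) := by exact_mod_cast h0
    generalize ((min |k| |l| : ℤ) : ℝ) = m at *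
    have h2 : m ^ (101 / 100 : ℝ) ≤ 1 / c * y := by
      rw [div_mul_eq_mul_div, le_div_iff₀ hc]; linarith
    calc (1 + m) ^ (101 / 100 : ℝ) ≤ (2 * m) ^ (101 / 100 : ℝ) :=
          Real.rpow_le_rpow (by linarith) (by linarith) (by norm_num)
      _ = 2 ^ (101 / 100 : ℝ) * m ^ (101 / 100 : ℝ) := Real.mul_rpow (by norm_num) (by linarith)
      _ ≤ 4 * (1 / c * y) := by
          refine mul_le_mul ?_ h2 (by positivity) (by norm_num)
          calc (2 : ℝ) ^ (101 / 100 : ℝ) ≤ 2 ^ (2 : ℝ) :=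
                Real.rpow_le_rpow_of_exponent_le (by norm_num) (by norm_num)
            _ = 4 := by norm_num
      _ ≤ _ := by nlinarith [mul_nonneg hc'.le hJ0]

/-- Bound of the multiplier when `j₁` is the largest of the inner frequencies. -/
theorem M2_le {c : ℝ} (hc : 0 < c) {j₁ j₂ j₃ k₂ k₃ : ℤ}
    (hΦ : Phi (j₁ + j₂ + j₃) k₂ k₃ ≠ 0) (h₂ : |j₂| ≤ |j₁|) (h₃ : |j₃| ≤ |j₁|)
    (h : c * ((min |j₁ + j₂ + j₃ + k₂ + k₃| |j₁ + j₂ + j₃| : ℤ) : ℝ) ^ (101 / 100 : ℝ) ≤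
      (|j₁| : ℤ)) :
    ENNReal.ofReal (M2 (1 / 2) j₁ j₂ j₃ k₂ k₃) ≤
      ENNReal.ofReal (16 * (1 + 1 / c)) *
        (jbw (-(501 / 1000)) j₂ * jbw (-(501 / 1000)) j₃) *
        resWeight (1 / 1000) (j₁ + j₂ + j₃) k₂ k₃ := by
  have hsqrt := sqrt_mul_rpow_le (c := 4 * (1 + 1 / c))
    (M := min (jb (j₁ + j₂ + j₃ + k₂ + k₃)) (jb (j₁ + j₂ + j₃)))
    (a := jb j₁) (b := jb j₂) (d := jb j₃) (le_min (one_le_jb _) (one_le_jb _))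
    (one_le_jb _) (one_le_jb _) (one_le_jb _)
    (jb_le_jb h₂) (jb_le_jb h₃)
    (by have : 0 < 1 / c := by positivity
        linarith) (min_jb_rpow_le hc h)
  unfold M2
  clear h h₂ h₃
  generalize hk₁ : j₁ + j₂ + j₃ = k₁ at *
  rw [Phi_eq] at *
  have hne : k₂ + k₃ ≠ 0 ∧ k₁ + k₃ ≠ 0 ∧ k₁ + k₂ ≠ 0 := by
    refine ⟨?_, ?_, ?_⟩ <;> rintro h <;> simp [h] at hΦ
  obtain ⟨ha, hb, hd⟩ := hne
  obtain ⟨P, hP0, hP, hprod⟩ := jb_prod_le_sq ha hb hd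
  have hKabs : |((k₁ + k₂ + k₃ : ℤ) : ℝ)| ≤ jb (k₁ + k₂ + k₃) := by unfold jb; linarith
  have hw1 := jb_le_two_mul_abs ha
  have hw2 := jb_le_two_mul_abs hb
  have hw3 := jb_le_two_mul_abs hd
  have h1 : (0 : ℝ) < |((k₂ + k₃ : ℤ) : ℝ)| := abs_pos.2 (by exact_mod_cast ha)
  have h2 : (0 : ℝ) < |((k₁ + k₃ : ℤ) : ℝ)| := abs_pos.2 (by exact_mod_cast hb)
  have h3 : (0 : ℝ) < |((k₁ + k₂ : ℤ) : ℝ)| := abs_pos.2 (by exact_mod_cast hd)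
  have hΦabs : |((3 * (k₂ + k₃) * (k₁ + k₃) * (k₁ + k₂) : ℤ) : ℝ)| =
      3 * |((k₂ + k₃ : ℤ) : ℝ)| * |((k₁ + k₃ : ℤ) : ℝ)| * |((k₁ + k₂ : ℤ) : ℝ)| := by
    push_cast; simp [abs_mul]
  rw [hΦabs]
  simp only [resWeight, jbw]
  have pK := jb_pos (k₁ + k₂ + k₃)
  have pK1 := jb_pos k₁
  have pK2 := jb_pos k₂
  have pK3 := jb_pos k₃
  have pj1 := jb_pos j₁
  have pj2 := jb_pos j₂
  have pj3 := jb_pos j₃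
  have pw1 := jb_pos (k₂ + k₃)
  have pw2 := jb_pos (k₁ + k₃)
  have pw3 := jb_pos (k₁ + k₂)
  generalize |((k₁ + k₂ + k₃ : ℤ) : ℝ)| = X at *
  generalize |((k₂ + k₃ : ℤ) : ℝ)| = D₁ at *
  generalize |((k₁ + k₃ : ℤ) : ℝ)| = D₂ at *
  generalize |((k₁ + k₂ : ℤ) : ℝ)| = D₃ at *
  generalize jb (k₁ + k₂ + k₃) = K at *
  generalize jb (k₂ + k₃) = w₁ at *
  generalize jb (k₁ + k₃) = w₂ at *
  generalize jb (k₁ + k₂) = w₃ at *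
  generalize jb k₁ = K₁ at *
  generalize jb k₂ = K₂ at *
  generalize jb k₃ = K₃ at *
  generalize jb j₁ = a at *
  generalize jb j₂ = b at *
  generalize jb j₃ = d at *
  have hm0 : 0 < min K K₁ := lt_min pK pK1
  have hδ : (min K K₁) ^ (-(1 / 1000) : ℝ) ≤ K₁ ^ (-(1 / 1000) : ℝ) + K ^ (-(1 / 1000) : ℝ) := by
    have q1 : 0 ≤ K₁ ^ (-(1 / 1000) : ℝ) := by positivity
    have q2 : 0 ≤ K ^ (-(1 / 1000) : ℝ) := by positivity
    rcases min_choice K K₁ with e | e <;> rw [e] <;> linarith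
  generalize min K K₁ = M at *
  -- the square root of the product estimate
  have hroot : K * K ^ (1 / 2 : ℝ) * K₁ ≤
      6 * (M ^ (1 / 2 : ℝ) * K₂ ^ (1 / 2 : ℝ) * K₃ ^ (1 / 2 : ℝ)) * P := by
    refine (sq_le_sq₀ (by positivity) (by positivity)).1 ?_
    have sq : ∀ x : ℝ, 0 < x → (x ^ (1 / 2 : ℝ)) ^ 2 = x := fun x hx => by
      rw [← Real.sqrt_eq_rpow, Real.sq_sqrt hx.le]
    simp only [mul_pow, sq K pK, sq M hm0, sq K₂ pK2, sq K₃ pK3]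
    nlinarith
  have hPdiv : P / (D₁ * D₂ * D₃) ≤ 2 * (w₁⁻¹ + w₂⁻¹ + w₃⁻¹) := by
    have i1 : D₁⁻¹ ≤ 2 * w₁⁻¹ := by
      rw [← div_eq_mul_inv, inv_le_comm₀ h1 (by positivity), inv_div]; linarith
    have i2 : D₂⁻¹ ≤ 2 * w₂⁻¹ := by
      rw [← div_eq_mul_inv, inv_le_comm₀ h2 (by positivity), inv_div]; linarith
    have i3 : D₃⁻¹ ≤ 2 * w₃⁻¹ := by
      rw [← div_eq_mul_inv, inv_le_comm₀ h3 (by positivity), inv_div]; linarith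
    calc P / (D₁ * D₂ * D₃) ≤ (D₂ * D₃ + D₁ * D₃ + D₁ * D₂) / (D₁ * D₂ * D₃) := by gcongr
      _ = D₁⁻¹ + D₂⁻¹ + D₃⁻¹ := by field_simp
      _ ≤ _ := by linarith
  have hreal : X * K ^ (1 / 2 : ℝ) * K₁ / (3 * D₁ * D₂ * D₃ * a ^ (1 / 2 : ℝ) * b ^ (1 / 2 : ℝ) *
      d ^ (1 / 2 : ℝ) * K₂ ^ (1 / 2 : ℝ) * K₃ ^ (1 / 2 : ℝ)) ≤
      16 * (1 + 1 / c) * (b ^ (-(501 / 1000) : ℝ) * d ^ (-(501 / 1000) : ℝ)) *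
        ((K₁ ^ (-(1 / 1000) : ℝ) + K ^ (-(1 / 1000) : ℝ)) *
          (w₁ ^ (-1 : ℝ) + w₂ ^ (-1 : ℝ) + w₃ ^ (-1 : ℝ))) := by
    simp only [Real.rpow_neg_one]
    calc _ ≤ (6 * (M ^ (1 / 2 : ℝ) * K₂ ^ (1 / 2 : ℝ) * K₃ ^ (1 / 2 : ℝ)) * P) /
          (3 * D₁ * D₂ * D₃ * a ^ (1 / 2 : ℝ) * b ^ (1 / 2 : ℝ) *
          d ^ (1 / 2 : ℝ) * K₂ ^ (1 / 2 : ℝ) * K₃ ^ (1 / 2 : ℝ)) := by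
          refine div_le_div_of_nonneg_right (le_trans ?_ hroot) (by positivity)
          gcongr
      _ = 2 * (M ^ (1 / 2 : ℝ) / (a ^ (1 / 2 : ℝ) * b ^ (1 / 2 : ℝ) * d ^ (1 / 2 : ℝ))) *
          (P / (D₁ * D₂ * D₃)) := by field_simp; ring
      _ ≤ 2 * (4 * (1 + 1 / c) * ((K₁ ^ (-(1 / 1000) : ℝ) + K ^ (-(1 / 1000) : ℝ)) *
          (b ^ (-(501 / 1000) : ℝ) * d ^ (-(501 / 1000) : ℝ)))) *
          (2 * (w₁⁻¹ + w₂⁻¹ + w₃⁻¹)) := by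
          gcongr
          refine hsqrt.trans ?_
          gcongr
      _ = _ := by ring
  refine (ENNReal.ofReal_le_ofReal hreal).trans_eq ?_
  rw [← ENNReal.ofReal_mul (by positivity), ← ENNReal.ofReal_add (by positivity) (by positivity),
    ← ENNReal.ofReal_add (by positivity) (by positivity),
    ← ENNReal.ofReal_add (by positivity) (by positivity),
    ← ENNReal.ofReal_mul (by positivity), ← ENNReal.ofReal_mul (by positivity),
    ← ENNReal.ofReal_mul (by positivity)]

/-! ### Summation -/

/-- The dominating summand in the case where the first inner frequency is the largest. -/
noncomputable def domTerm (U Z : ℤ → ℝ≥0∞) (j₁ j₂ j₃ k₂ k₃ : ℤ) : ℝ≥0∞ :=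
  (U j₂ * jbw (-(501 / 1000)) j₂) * (U j₃ * jbw (-(501 / 1000)) j₃) *
    (U j₁ * U k₂ * U k₃ * Z (j₁ + j₂ + j₃ + k₂ + k₃) *
      resWeight (1 / 1000) (j₁ + j₂ + j₃) k₂ k₃)

theorem tsum_domTerm_le (U Z : ℤ → ℝ≥0∞) :
    ∑' q : ℤ × ℤ × ℤ × ℤ × ℤ, domTerm U Z q.1 q.2.1 q.2.2.1 q.2.2.2.1 q.2.2.2.2 ≤
      eL2 (jbw (-(501 / 1000))) ^ 2 * (6 * bilinearConst (1 / 1000)) *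
        (eL2 U ^ 5 * eL2 Z) := by
  set g : ℤ → ℝ≥0∞ := jbw (-(501 / 1000)) with hg
  set G : ℤ × ℤ × ℤ × ℤ × ℤ → ℝ≥0∞ := fun r => (U r.1 * g r.1) * ((U r.2.1 * g r.2.1) *
    (U (r.2.2.1 - r.1 - r.2.1) * U r.2.2.2.1 * U r.2.2.2.2 *
      Z (r.2.2.1 + r.2.2.2.1 + r.2.2.2.2) *
      resWeight (1 / 1000) r.2.2.1 r.2.2.2.1 r.2.2.2.2)) with hG
  let φ : ℤ × ℤ × ℤ × ℤ × ℤ → ℤ × ℤ × ℤ × ℤ × ℤ := fun q =>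
    (q.2.1, q.2.2.1, q.1 + q.2.1 + q.2.2.1, q.2.2.2.1, q.2.2.2.2)
  have hφ : Function.Injective φ := fun p q h => by
    simp only [φ, Prod.mk.injEq] at h; ext <;> omega
  have hcomp : ∀ q : ℤ × ℤ × ℤ × ℤ × ℤ,
      domTerm U Z q.1 q.2.1 q.2.2.1 q.2.2.2.1 q.2.2.2.2 = G (φ q) := by
    rintro ⟨a, b, d, x, y⟩
    simp only [domTerm, hG, φ, ← hg]
    rw [show a + b + d - b - d = a by ring]
    ring
  simp only [hcomp]
  refine (ENNReal.tsum_comp_le_tsum_of_injective hφ G).trans ?_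
  have hUg : ∑' j, U j * g j ≤ eL2 U * eL2 g := tsum_mul_le_eL2 _ _
  have hin : ∀ b d : ℤ, ∑' p : ℤ × ℤ × ℤ, U (p.1 - b - d) * U p.2.1 * U p.2.2 *
      Z (p.1 + p.2.1 + p.2.2) * resWeight (1 / 1000) p.1 p.2.1 p.2.2 ≤
      6 * bilinearConst (1 / 1000) * (eL2 U ^ 3 * eL2 Z) := fun b d => by
    refine (tsum_resWeight_le (by norm_num) (by norm_num)
      (fun x => U (x - b - d)) U U Z).trans_eq ?_
    rw [show eL2 (fun x => U (x - b - d)) = eL2 U from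
      eL2_comp_equiv ((Equiv.subRight b).trans (Equiv.subRight d)) U]
    ring
  rw [ENNReal.tsum_prod']
  calc _ ≤ ∑' b, (U b * g b) * ((eL2 U * eL2 g) *
        (6 * bilinearConst (1 / 1000) * (eL2 U ^ 3 * eL2 Z))) := by
        refine ENNReal.tsum_le_tsum fun b => ?_
        simp only [hG]
        rw [ENNReal.tsum_mul_left]
        refine mul_le_mul_right ?_ _
        rw [ENNReal.tsum_prod']
        refine le_trans (ENNReal.tsum_le_tsum fun d => ?_)
          (le_trans (ENNReal.tsum_mul_right (a :=
            6 * bilinearConst (1 / 1000) * (eL2 U ^ 3 * eL2 Z))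
            (f := fun d => U d * g d)).le (mul_le_mul_left hUg _))
        dsimp only
        rw [ENNReal.tsum_mul_left]
        exact mul_le_mul_right (hin b d) _
    _ ≤ (eL2 U * eL2 g) * ((eL2 U * eL2 g) *
        (6 * bilinearConst (1 / 1000) * (eL2 U ^ 3 * eL2 Z))) := by
        rw [ENNReal.tsum_mul_right]
        exact mul_le_mul_left hUg _
    _ = _ := by ring

theorem M2_nonneg (s : ℝ) (j₁ j₂ j₃ k₂ k₃ : ℤ) : 0 ≤ M2 s j₁ j₂ j₃ k₂ k₃ := by
  have := fun k => (jb_pos k).le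
  unfold M2
  refine div_nonneg (mul_nonneg (mul_nonneg (abs_nonneg _) (Real.rpow_nonneg (this _) _))
    (this _)) ?_
  have hr := fun k => Real.rpow_nonneg (this k) s
  exact mul_nonneg (mul_nonneg (mul_nonneg (mul_nonneg (mul_nonneg (abs_nonneg _) (hr _)) (hr _))
    (hr _)) (hr _)) (hr _)

theorem M2_swap₁₂ (s : ℝ) (j₁ j₂ j₃ k₂ k₃ : ℤ) :
    M2 s j₁ j₂ j₃ k₂ k₃ = M2 s j₂ j₁ j₃ k₂ k₃ := by
  unfold M2
  rw [add_comm j₁ j₂]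
  ring

theorem M2_swap₁₃ (s : ℝ) (j₁ j₂ j₃ k₂ k₃ : ℤ) :
    M2 s j₁ j₂ j₃ k₂ k₃ = M2 s j₃ j₂ j₁ k₂ k₃ := by
  unfold M2
  rw [show j₁ + j₂ + j₃ = j₃ + j₂ + j₁ by ring]
  ring

theorem ofReal_term_le {c : ℝ} (hc : 0 < c) {u z : ℤ → ℝ} (hu : ∀ k, 0 ≤ u k)
    (j₁ j₂ j₃ k₂ k₃ : ℤ) :
    ENNReal.ofReal (term17 c u z j₁ j₂ j₃ k₂ k₃) ≤
      ENNReal.ofReal (16 * (1 + 1 / c)) *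
        (domTerm (fun k => ENNReal.ofReal (u k)) (fun k => ENNReal.ofReal (z k)) j₁ j₂ j₃ k₂ k₃ +
        domTerm (fun k => ENNReal.ofReal (u k)) (fun k => ENNReal.ofReal (z k)) j₂ j₁ j₃ k₂ k₃ +
        domTerm (fun k => ENNReal.ofReal (u k)) (fun k => ENNReal.ofReal (z k))
          j₃ j₂ j₁ k₂ k₃) := by
  have main : ∀ a b d : ℤ, Phi (a + b + d) k₂ k₃ ≠ 0 → |b| ≤ |a| → |d| ≤ |a| →
      c * ((min |a + b + d + k₂ + k₃| |a + b + d| : ℤ) : ℝ) ^ (101 / 100 : ℝ) ≤ (|a| : ℤ) →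
      ENNReal.ofReal (M2 (1 / 2) a b d k₂ k₃ *
        (u a * u b * u d * u k₂ * u k₃ * z (a + b + d + k₂ + k₃))) ≤
      ENNReal.ofReal (16 * (1 + 1 / c)) *
        domTerm (fun k => ENNReal.ofReal (u k)) (fun k => ENNReal.ofReal (z k)) a b d k₂ k₃ := by
    intro a b d hΦ hb hd h
    have hua := hu a
    have hub := hu b
    have hud := hu d
    have hu2 := hu k₂
    have hu3 := hu k₃
    rw [ENNReal.ofReal_mul (M2_nonneg _ _ _ _ _ _), ENNReal.ofReal_mul (by positivity),
      ENNReal.ofReal_mul (by positivity), ENNReal.ofReal_mul (by positivity),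
      ENNReal.ofReal_mul (by positivity), ENNReal.ofReal_mul (by positivity)]
    refine (mul_le_mul_left (M2_le hc hΦ hb hd h) _).trans_eq ?_
    unfold domTerm
    ring
  simp only [term17]
  split_ifs with hcond
  swap
  · simp
  obtain ⟨hΦ, hmax⟩ := hcond
  by_cases c1 : |j₂| ≤ |j₁| ∧ |j₃| ≤ |j₁|
  · rw [max_eq_left c1.1, max_eq_left c1.2] at hmax
    refine (main j₁ j₂ j₃ hΦ c1.1 c1.2 hmax).trans (mul_le_mul_right ?_ _)
    rw [add_assoc]
    exact le_self_add
  by_cases c2 : |j₁| ≤ |j₂| ∧ |j₃| ≤ |j₂|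
  · rw [max_eq_right c2.1, max_eq_left c2.2] at hmax
    have e : j₁ + j₂ + j₃ = j₂ + j₁ + j₃ := by ring
    rw [M2_swap₁₂, mul_comm (u j₁) (u j₂), e]
    rw [e] at hΦ hmax
    refine (main j₂ j₁ j₃ hΦ c2.1 c2.2 hmax).trans (mul_le_mul_right ?_ _)
    exact le_add_right le_add_self
  have c3 : |j₁| ≤ |j₃| ∧ |j₂| ≤ |j₃| := by omega
  rw [max_eq_right (max_le c3.1 c3.2)] at hmax
  have e : j₁ + j₂ + j₃ = j₃ + j₂ + j₁ := by ring
  rw [M2_swap₁₃, show u j₁ * u j₂ * u j₃ = u j₃ * u j₂ * u j₁ by ring, e]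
  rw [e] at hΦ hmax
  refine (main j₃ j₂ j₁ hΦ c3.2 c3.1 hmax).trans (mul_le_mul_right ?_ _)
  exact le_add_self

/-- Restricted quintic `M₂` estimate at `s = 1/2`, case (c). -/
theorem M2_restricted_c (c : ℝ) (hc : 0 < c) :
    ∃ C > (0 : ℝ), ∀ u z : ℤ → ℝ, (∀ k, 0 ≤ u k) → (∀ k, 0 ≤ z k) →
      l2 u < ⊤ → l2 z < ⊤ →
      (∑' q : ℤ × ℤ × ℤ × ℤ × ℤ,
        ENNReal.ofReal (term17 c u z q.1 q.2.1 q.2.2.1 q.2.2.2.1 q.2.2.2.2)) ≤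
        ENNReal.ofReal C * l2 u ^ 5 * l2 z := by
  set T : ℝ≥0∞ := ENNReal.ofReal (16 * (1 + 1 / c)) *
    (3 * (eL2 (jbw (-(501 / 1000))) ^ 2 * (6 * bilinearConst (1 / 1000)))) with hT
  have hTtop : T < ⊤ := by
    have hb := bilinearConst_lt_top (δ := 1 / 1000) (by norm_num)
    have hg : eL2 (jbw (-(501 / 1000))) < ⊤ := by
      refine ENNReal.rpow_lt_top_of_nonneg (by norm_num) (ne_of_lt ?_)
      simp only [jbw_sq]
      exact tsum_jbw_lt_top (by norm_num)
    exact ENNReal.mul_lt_top ENNReal.ofReal_lt_top (ENNReal.mul_lt_top (by simp)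
      (ENNReal.mul_lt_top (ENNReal.pow_lt_top hg) (ENNReal.mul_lt_top (by simp) hb)))
  refine ⟨T.toReal + 1, by positivity, fun u z hu hz _ _ => ?_⟩
  have hTC : T ≤ ENNReal.ofReal (T.toReal + 1) :=
    (ENNReal.ofReal_toReal hTtop.ne).symm.le.trans (ENNReal.ofReal_le_ofReal (by linarith))
  rw [l2_eq_eL2 hu, l2_eq_eL2 hz, mul_assoc]
  refine le_trans ?_ (mul_le_mul_left hTC _)
  set U : ℤ → ℝ≥0∞ := fun k => ENNReal.ofReal (u k)
  set Z : ℤ → ℝ≥0∞ := fun k => ENNReal.ofReal (z k)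
  have hperm : ∀ φ : ℤ × ℤ × ℤ × ℤ × ℤ → ℤ × ℤ × ℤ × ℤ × ℤ, Function.Injective φ →
      ∑' q, (fun q : ℤ × ℤ × ℤ × ℤ × ℤ =>
        domTerm U Z q.1 q.2.1 q.2.2.1 q.2.2.2.1 q.2.2.2.2) (φ q) ≤ _ := fun φ hφ =>
    (ENNReal.tsum_comp_le_tsum_of_injective hφ _).trans (tsum_domTerm_le U Z)
  refine (ENNReal.tsum_le_tsum fun q => ofReal_term_le hc hu _ _ _ _ _).trans ?_
  rw [ENNReal.tsum_mul_left, ENNReal.tsum_add, ENNReal.tsum_add, hT, mul_assoc]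
  refine mul_le_mul_right ?_ _
  refine (add_le_add (add_le_add (tsum_domTerm_le U Z)
    (hperm (fun q => (q.2.1, q.1, q.2.2.1, q.2.2.2.1, q.2.2.2.2)) fun p q h => by
      simp only [Prod.mk.injEq] at h; ext <;> omega))
    (hperm (fun q => (q.2.2.1, q.2.1, q.1, q.2.2.2.1, q.2.2.2.2)) fun p q h => by
      simp only [Prod.mk.injEq] at h; ext <;> omega)).trans_eq ?_
  ring
end

section
/- For all c₁, c₂, c₃ > 0 there is C > 0 such that for all u, z : ℤ → [0,∞) with ‖u‖_{ℓ²}, ‖z‖_{ℓ²} < ∞: the sum of M₂ · u(j₁) u(j₂) u(j₃) u(k₂) u(k₃) z(k) over all integer tuples with k = k₁+k₂+k₃, k₁ = j₁+j₂+j₃, Φ(k̄) ≠ 0, Φ(j̄) ≠ 0, |Φ(k̄)| ≥ c₁ (k*)² λ_k, min(|j₁|,|j₂|,|j₃|) ≥ c₂ · max(|j₁|,|j₂|,|j₃|), and Λ_j ≤ c₃ · max(|k₂|,|k₃|)^{1/100}, is at most C ‖u‖⁵_{ℓ²} ‖z‖_{ℓ²}, where M₂ := |k| ⟨k⟩^{1/2}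 ⟨k₁⟩ / (|Φ(k̄)| ⟨j₁⟩^{1/2} ⟨j₂⟩^{1/2} ⟨j₃⟩^{1/2} ⟨k₂⟩^{1/2} ⟨k₃⟩^{1/2}). -/
open scoped ENNReal

open Classical in
/-- Summand for the restricted `M₂` estimate: case (d), where `|Φ(k̄)| ≳ (k*)² λ_k`,
`Φ(j̄)` is in the regime `|j₁| ∼ |j₂| ∼ |j₃|`, and `Λ_j ≲ max(|k₂|,|k₃|)^{1/100}`. -/
noncomputable def term18 (c₁ c₂ c₃ : ℝ) (u z : ℤ → ℝ) (j₁ j₂ j₃ k₂ k₃ : ℤ) : ℝ :=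
  let k₁ := j₁ + j₂ + j₃
  let k := k₁ + k₂ + k₃
  if Phi k₁ k₂ k₃ ≠ 0 ∧ Phi j₁ j₂ j₃ ≠ 0 ∧
      c₁ * ((kstar k₁ k₂ k₃ : ℤ) : ℝ) ^ 2 * ((lam k₁ k₂ k₃ : ℤ) : ℝ) ≤
        |((Phi k₁ k₂ k₃ : ℤ) : ℝ)| ∧
      c₂ * ((max (max |j₁| |j₂|) |j₃| : ℤ) : ℝ) ≤ ((min (min |j₁| |j₂|) |j₃| : ℤ) : ℝ) ∧
      ((Lam j₁ j₂ j₃ : ℤ) : ℝ) ≤ c₃ * ((max |k₂| |k₃| : ℤ) : ℝ) ^ (1 / 100 : ℝ) then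
    M2 (1 / 2) j₁ j₂ j₃ k₂ k₃ * (u j₁ * u j₂ * u j₃ * u k₂ * u k₃ * z k)
  else 0

/-- The Hölder inequality with exponents `(2, 2)` for sums of extended nonnegative reals. -/
theorem tsum_mul_le_l2 {ι : Type*} (f g : ι → ℝ≥0∞) :
    ∑' i, f i * g i ≤
      (∑' i, f i ^ 2) ^ (1 / 2 : ℝ) * (∑' i, g i ^ 2) ^ (1 / 2 : ℝ) := by
  let _ : MeasurableSpace ι := ⊤
  have h := ENNReal.lintegral_mul_le_Lp_mul_Lq
    (MeasureTheory.Measure.count : MeasureTheory.Measure ι)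
    Real.HolderConjugate.two_two (f := f) (g := g)
    (measurable_from_top.aemeasurable) (measurable_from_top.aemeasurable)
  simpa [MeasureTheory.lintegral_count] using h

theorem le_l2_norm {ι : Type*} (f : ι → ℝ≥0∞) (i : ι) :
    f i ≤ (∑' i, f i ^ 2) ^ (1 / 2 : ℝ) := by
  calc f i = (f i ^ 2) ^ (1 / 2 : ℝ) := by
        rw [← ENNReal.rpow_natCast, ← ENNReal.rpow_mul]; norm_num
    _ ≤ _ := ENNReal.rpow_le_rpow (ENNReal.le_tsum i) (by norm_num)

/-- Two weights on the pair sums of a triple control a cubic expression dual to `ℓ²`. -/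
theorem tsum_triple_le (w U Z : ℤ → ℝ≥0∞) (m : ℤ) :
    ∑' (x : ℤ) (y : ℤ) (t : ℤ),
      w (x + y) * w (y + t) * (U x * U y * U t * Z (x + y + t + m)) ≤
    (∑' a, w a) ^ 2 *
      ((∑' i, U i ^ 2) ^ (1 / 2 : ℝ)) ^ 3 * (∑' i, Z i ^ 2) ^ (1 / 2 : ℝ) := by
  set N := (∑' i, U i ^ 2) ^ (1 / 2 : ℝ) with hN
  set M := (∑' i, Z i ^ 2) ^ (1 / 2 : ℝ) with hM
  have hin (a b : ℤ) : ∑' y : ℤ, U (a - y) * U y * U (b - y) * Z (a + b - y + m) ≤ N ^ 3 * M := by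
    have hZ : (∑' y : ℤ, Z (a + b - y + m) ^ 2) ^ (1 / 2 : ℝ) = M := by
      rw [hM, ← (Equiv.subLeft (a + b + m)).tsum_eq (fun i => Z i ^ 2)]
      congr 2; ext y; simp only [Equiv.subLeft_apply]; congr 2; ring
    calc ∑' y : ℤ, U (a - y) * U y * U (b - y) * Z (a + b - y + m)
        ≤ ∑' y : ℤ, N ^ 2 * (U y * Z (a + b - y + m)) := by
          refine ENNReal.tsum_le_tsum fun y => ?_
          calc _ = (U (a - y) * U (b - y)) * (U y * Z (a + b - y + m)) := by ring
            _ ≤ (N * N) * (U y * Z (a + b - y + m)) := by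
              gcongr <;> exact le_l2_norm U _
            _ = _ := by ring
      _ = N ^ 2 * ∑' y : ℤ, U y * Z (a + b - y + m) := ENNReal.tsum_mul_left
      _ ≤ N ^ 2 * (N * M) := by
          gcongr
          exact (tsum_mul_le_l2 U _).trans_eq (by rw [hZ])
      _ = _ := by ring
  have hshift (y : ℤ) (F : ℤ → ℤ → ℝ≥0∞) :
      ∑' (x : ℤ) (t : ℤ), F x t = ∑' (a : ℤ) (b : ℤ), F (a - y) (b - y) := by
    rw [← (Equiv.subRight y).tsum_eq (fun x => ∑' t, F x t)]
    congr 1; ext a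
    exact ((Equiv.subRight y).tsum_eq (fun t => F (a - y) t)).symm
  calc _ = ∑' (y : ℤ) (x : ℤ) (t : ℤ),
        w (x + y) * w (y + t) * (U x * U y * U t * Z (x + y + t + m)) := ENNReal.tsum_comm
    _ = ∑' (y : ℤ) (a : ℤ) (b : ℤ),
        w a * w b * (U (a - y) * U y * U (b - y) * Z (a + b - y + m)) := by
      congr 1; ext y; rw [hshift y]
      congr 1; ext a; congr 1; ext b
      rw [show a - y + y = a by ring, show y + (b - y) = b by ring,
        show a + (b - y) + m = a + b - y + m by ring]
    _ = ∑' (a : ℤ) (b : ℤ), w a * w b *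
        ∑' y : ℤ, U (a - y) * U y * U (b - y) * Z (a + b - y + m) := by
      rw [ENNReal.tsum_comm]
      congr 1; ext a
      rw [ENNReal.tsum_comm]
      simp_rw [ENNReal.tsum_mul_left]
    _ ≤ ∑' (a : ℤ) (b : ℤ), w a * w b * (N ^ 3 * M) := by
      gcongr with a b; exact hin a b
    _ = (∑' a, w a) ^ 2 * (N ^ 3 * M) := by
      simp_rw [ENNReal.tsum_mul_right, ENNReal.tsum_mul_left, ENNReal.tsum_mul_right]
      ring
    _ = _ := by ring

theorem jb_le_two_mul_abs_s18 {k : ℤ} (hk : k ≠ 0) : jb k ≤ 2 * |(k : ℝ)| := by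
  have : (1 : ℝ) ≤ |(k : ℝ)| := by exact_mod_cast Int.one_le_abs hk
  unfold jb; linarith

theorem summable_jb_rpow {p : ℝ} (hp : 1 < p) : Summable fun k : ℤ => jb k ^ (-p) := by
  have h : Summable fun n : ℕ => (1 + (n : ℝ)) ^ (-p) := by
    have := (summable_nat_add_iff 1).2 (Real.summable_nat_rpow.2 (neg_lt_neg hp))
    refine this.congr fun n => ?_
    push_cast; rw [add_comm]
  refine Summable.of_nat_of_neg ?_ ?_ <;> simpa [jb] using h

theorem Phi_eq_mul (a b c : ℤ) : Phi a b c = 3 * (a + b) * (b + c) * (c + a) := by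
  unfold Phi; ring

theorem pair_sums_ne_zero {a b c : ℤ} (h : Phi a b c ≠ 0) :
    a + b ≠ 0 ∧ b + c ≠ 0 ∧ c + a ≠ 0 := by
  rw [Phi_eq_mul] at h
  refine ⟨?_, ?_, ?_⟩ <;> intro h0 <;> simp [h0] at h

/-- In the regime `|Φ(k̄)| ≳ (k*)² λ_k` and `|j₁| ∼ |j₂| ∼ |j₃|`, the multiplier `M₂` gains
`3/4` of a derivative on both `k₂` and `k₃`. -/
theorem M2_le_s18 {c₁ c₂ : ℝ} (hc₁ : 0 < c₁) (hc₂ : 0 < c₂) {j₁ j₂ j₃ k₂ k₃ : ℤ}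
    (hk : Phi (j₁ + j₂ + j₃) k₂ k₃ ≠ 0) (hj : Phi j₁ j₂ j₃ ≠ 0)
    (hPhi : c₁ * ((kstar (j₁ + j₂ + j₃) k₂ k₃ : ℤ) : ℝ) ^ 2 *
      ((lam (j₁ + j₂ + j₃) k₂ k₃ : ℤ) : ℝ) ≤ |((Phi (j₁ + j₂ + j₃) k₂ k₃ : ℤ) : ℝ)|)
    (hcomp : c₂ * ((max (max |j₁| |j₂|) |j₃| : ℤ) : ℝ) ≤
      ((min (min |j₁| |j₂|) |j₃| : ℤ) : ℝ)) :
    M2 (1 / 2) j₁ j₂ j₃ k₂ k₃ ≤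
      48 / (c₁ * (c₂ ^ (1 / 2 : ℝ)) ^ 3) * (jb k₂ * jb k₃) ^ (-(3 / 4) : ℝ) := by
  obtain ⟨hk12, hk23, hk31⟩ := pair_sums_ne_zero hk
  obtain ⟨hj12, -, -⟩ := pair_sums_ne_zero hj
  have hlam : (1 : ℝ) ≤ (lam (j₁ + j₂ + j₃) k₂ k₃ : ℤ) := by
    have : 1 ≤ lam (j₁ + j₂ + j₃) k₂ k₃ :=
      le_min (le_min (Int.one_le_abs hk12) (Int.one_le_abs hk23)) (Int.one_le_abs hk31)
    exact_mod_cast this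
  have hS1 : (1 : ℤ) ≤ kstar (j₁ + j₂ + j₃) k₂ k₃ := by
    simp only [kstar, abs_eq_max_neg]; omega
  have hS1' : (1 : ℝ) ≤ (kstar (j₁ + j₂ + j₃) k₂ k₃ : ℤ) := by exact_mod_cast hS1
  have hJ1 : (1 : ℤ) ≤ max (max |j₁| |j₂|) |j₃| := by
    simp only [abs_eq_max_neg]; omega
  have hJ1' : (1 : ℝ) ≤ (max (max |j₁| |j₂|) |j₃| : ℤ) := by exact_mod_cast hJ1
  have hkS : |((j₁ + j₂ + j₃ + k₂ + k₃ : ℤ) : ℝ)| ≤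
      3 * (kstar (j₁ + j₂ + j₃) k₂ k₃ : ℤ) := by
    have : |j₁ + j₂ + j₃ + k₂ + k₃| ≤ 3 * kstar (j₁ + j₂ + j₃) k₂ k₃ := by
      simp only [kstar, abs_eq_max_neg]; omega
    exact_mod_cast this
  have hk2S : jb k₂ ≤ 2 * (kstar (j₁ + j₂ + j₃) k₂ k₃ : ℤ) := by
    have : 1 + |k₂| ≤ 2 * kstar (j₁ + j₂ + j₃) k₂ k₃ := by unfold kstar at *; omega
    unfold jb; exact_mod_cast this
  have hk3S : jb k₃ ≤ 2 * (kstar (j₁ + j₂ + j₃) k₂ k₃ : ℤ) := by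
    have : 1 + |k₃| ≤ 2 * kstar (j₁ + j₂ + j₃) k₂ k₃ := by unfold kstar at *; omega
    unfold jb; exact_mod_cast this
  have hk1J : jb (j₁ + j₂ + j₃) ≤ 4 * (max (max |j₁| |j₂|) |j₃| : ℤ) := by
    have : 1 + |j₁ + j₂ + j₃| ≤ 4 * max (max |j₁| |j₂|) |j₃| := by
      simp only [abs_eq_max_neg] at hJ1 ⊢; omega
    unfold jb; exact_mod_cast this
  have hmin (j : ℤ) (h : min (min |j₁| |j₂|) |j₃| ≤ |j|) :
      c₂ * (max (max |j₁| |j₂|) |j₃| : ℤ) ≤ jb j := by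
    have : ((min (min |j₁| |j₂|) |j₃| : ℤ) : ℝ) ≤ |(j : ℝ)| := by exact_mod_cast h
    unfold jb; linarith
  have hx1 := hmin j₁ (by omega)
  have hx2 := hmin j₂ (by omega)
  have hx3 := hmin j₃ (by omega)
  have hkb : jb (j₁ + j₂ + j₃ + k₂ + k₃) ≤ 4 * (kstar (j₁ + j₂ + j₃) k₂ k₃ : ℤ) := by
    unfold jb; linarith
  generalize ((kstar (j₁ + j₂ + j₃) k₂ k₃ : ℤ) : ℝ) = S at *
  generalize ((max (max |j₁| |j₂|) |j₃| : ℤ) : ℝ) = J at *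
  have hS0 : 0 < S := by linarith
  have hJ0 : 0 < J := by linarith
  have hP0 : 0 < jb k₂ * jb k₃ := mul_pos (jb_pos _) (jb_pos _)
  have hroot {x : ℝ} (h : c₂ * J ≤ x) :
      c₂ ^ (1 / 2 : ℝ) * J ^ (1 / 2 : ℝ) ≤ x ^ (1 / 2 : ℝ) := by
    rw [← Real.mul_rpow hc₂.le hJ0.le]
    exact Real.rpow_le_rpow (by positivity) h (by norm_num)
  have hJr : 1 ≤ J ^ (1 / 2 : ℝ) := Real.one_le_rpow hJ1' (by norm_num)
  have hJsq : (J ^ (1 / 2 : ℝ)) ^ 2 = J := by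
    rw [← Real.rpow_natCast, ← Real.rpow_mul hJ0.le]; norm_num
  have hm : 0 < c₂ ^ (1 / 2 : ℝ) := by positivity
  have hprod : (c₂ ^ (1 / 2 : ℝ)) ^ 3 * J ≤
      jb j₁ ^ (1 / 2 : ℝ) * jb j₂ ^ (1 / 2 : ℝ) * jb j₃ ^ (1 / 2 : ℝ) := by
    calc (c₂ ^ (1 / 2 : ℝ)) ^ 3 * J
        = (c₂ ^ (1 / 2 : ℝ)) ^ 3 * (J ^ (1 / 2 : ℝ)) ^ 2 * 1 := by rw [hJsq, mul_one]
      _ ≤ (c₂ ^ (1 / 2 : ℝ)) ^ 3 * (J ^ (1 / 2 : ℝ)) ^ 2 * J ^ (1 / 2 : ℝ) := by gcongr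
      _ = (c₂ ^ (1 / 2 : ℝ) * J ^ (1 / 2 : ℝ)) * (c₂ ^ (1 / 2 : ℝ) * J ^ (1 / 2 : ℝ)) *
          (c₂ ^ (1 / 2 : ℝ) * J ^ (1 / 2 : ℝ)) := by ring
      _ ≤ _ := by
        have h1 := hroot hx1
        have h2 := hroot hx2
        have h3 := hroot hx3
        have := jb_pos j₁
        have := jb_pos j₂
        gcongr
  have hA : c₁ * S ^ 2 ≤ |((Phi (j₁ + j₂ + j₃) k₂ k₃ : ℤ) : ℝ)| :=
    (le_mul_of_one_le_right (by positivity) hlam).trans hPhi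
  have hkr : jb (j₁ + j₂ + j₃ + k₂ + k₃) ^ (1 / 2 : ℝ) ≤ 2 * S ^ (1 / 2 : ℝ) := by
    calc _ ≤ (4 * S) ^ (1 / 2 : ℝ) :=
          Real.rpow_le_rpow (jb_pos _).le hkb (by norm_num)
      _ = 2 * S ^ (1 / 2 : ℝ) := by
        rw [Real.mul_rpow (by norm_num) hS0.le, show (4 : ℝ) = 2 ^ (2 : ℝ) by norm_num,
          ← Real.rpow_mul (by norm_num)]
        norm_num
  have hP4 : (jb k₂ * jb k₃) ^ (1 / 4 : ℝ) ≤ 2 * S ^ (1 / 2 : ℝ) := by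
    calc _ ≤ ((2 * S) * (2 * S)) ^ (1 / 4 : ℝ) := by
          have := jb_pos k₂
          have := jb_pos k₃
          gcongr
      _ = (2 * S) ^ (1 / 2 : ℝ) := by
        rw [show (2 * S) * (2 * S) = (2 * S) ^ (2 : ℝ) by rw [Real.rpow_two]; ring,
          ← Real.rpow_mul (by positivity)]
        norm_num
      _ ≤ (4 * S) ^ (1 / 2 : ℝ) := by gcongr; norm_num
      _ = 2 * S ^ (1 / 2 : ℝ) := by
        rw [Real.mul_rpow (by norm_num) hS0.le, show (4 : ℝ) = 2 ^ (2 : ℝ) by norm_num,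
          ← Real.rpow_mul (by norm_num)]
        norm_num
  have hden : c₁ * S ^ 2 * ((c₂ ^ (1 / 2 : ℝ)) ^ 3 * J) * (jb k₂ * jb k₃) ^ (1 / 2 : ℝ) ≤
      |((Phi (j₁ + j₂ + j₃) k₂ k₃ : ℤ) : ℝ)| * jb j₁ ^ (1 / 2 : ℝ) * jb j₂ ^ (1 / 2 : ℝ) *
        jb j₃ ^ (1 / 2 : ℝ) * jb k₂ ^ (1 / 2 : ℝ) * jb k₃ ^ (1 / 2 : ℝ) := by
    rw [Real.mul_rpow (jb_pos _).le (jb_pos _).le]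
    calc _ ≤ |((Phi (j₁ + j₂ + j₃) k₂ k₃ : ℤ) : ℝ)| *
          (jb j₁ ^ (1 / 2 : ℝ) * jb j₂ ^ (1 / 2 : ℝ) * jb j₃ ^ (1 / 2 : ℝ)) *
          (jb k₂ ^ (1 / 2 : ℝ) * jb k₃ ^ (1 / 2 : ℝ)) := by
          have := jb_pos k₂
          have := jb_pos k₃
          gcongr
      _ = _ := by ring
  have hnum : |((j₁ + j₂ + j₃ + k₂ + k₃ : ℤ) : ℝ)| *
      jb (j₁ + j₂ + j₃ + k₂ + k₃) ^ (1 / 2 : ℝ) * jb (j₁ + j₂ + j₃) ≤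
      3 * S * (2 * S ^ (1 / 2 : ℝ)) * (4 * J) := by
    have := jb_pos (j₁ + j₂ + j₃)
    have := jb_pos (j₁ + j₂ + j₃ + k₂ + k₃)
    gcongr
  have hPh : (jb k₂ * jb k₃) ^ (1 / 2 : ℝ) =
      (jb k₂ * jb k₃) ^ (3 / 4 : ℝ) / (jb k₂ * jb k₃) ^ (1 / 4 : ℝ) := by
    rw [← Real.rpow_sub hP0]; norm_num
  have hSsq : (S ^ (1 / 2 : ℝ)) ^ 2 = S := by
    rw [← Real.rpow_natCast, ← Real.rpow_mul hS0.le]; norm_num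
  calc M2 (1 / 2) j₁ j₂ j₃ k₂ k₃
      ≤ 3 * S * (2 * S ^ (1 / 2 : ℝ)) * (4 * J) /
        (c₁ * S ^ 2 * ((c₂ ^ (1 / 2 : ℝ)) ^ 3 * J) * (jb k₂ * jb k₃) ^ (1 / 2 : ℝ)) := by
        unfold M2
        exact div_le_div₀ (by positivity) hnum (by positivity) hden
    _ = 24 * (jb k₂ * jb k₃) ^ (1 / 4 : ℝ) * S ^ (1 / 2 : ℝ) /
        (c₁ * (c₂ ^ (1 / 2 : ℝ)) ^ 3 * S * (jb k₂ * jb k₃) ^ (3 / 4 : ℝ)) := by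
        rw [hPh]; field_simp; ring
    _ ≤ 24 * (2 * S ^ (1 / 2 : ℝ)) * S ^ (1 / 2 : ℝ) /
        (c₁ * (c₂ ^ (1 / 2 : ℝ)) ^ 3 * S * (jb k₂ * jb k₃) ^ (3 / 4 : ℝ)) := by gcongr
    _ = 48 * (S ^ (1 / 2 : ℝ)) ^ 2 /
        (c₁ * (c₂ ^ (1 / 2 : ℝ)) ^ 3 * S * (jb k₂ * jb k₃) ^ (3 / 4 : ℝ)) := by ring
    _ = _ := by rw [hSsq, Real.rpow_neg hP0.le]; field_simp

/-- A small product of nonzero integers is paid for by summable weights and a small power of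
`⟨k₂⟩⟨k₃⟩`. -/
theorem one_le_weight {c₃ : ℝ} (hc₃ : 0 < c₃) {a b k₂ k₃ : ℤ} (ha : a ≠ 0) (hb : b ≠ 0)
    (h : ((|a| * |b| : ℤ) : ℝ) ≤ c₃ * ((max |k₂| |k₃| : ℤ) : ℝ) ^ (1 / 100 : ℝ)) :
    1 ≤ (4 * c₃) ^ 2 * (jb k₂ * jb k₃) ^ (1 / 50 : ℝ) *
      (jb a ^ (-2 : ℝ) * jb b ^ (-2 : ℝ)) := by
  have hP0 : 0 < jb k₂ * jb k₃ := mul_pos (jb_pos _) (jb_pos _)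
  have hK : ((max |k₂| |k₃| : ℤ) : ℝ) ≤ jb k₂ * jb k₃ := by
    have h2 : 0 ≤ |(k₂ : ℝ)| := abs_nonneg _
    have h3 : 0 ≤ |(k₃ : ℝ)| := abs_nonneg _
    push_cast
    unfold jb
    apply max_le <;> nlinarith
  have hK0 : (0 : ℝ) ≤ ((max |k₂| |k₃| : ℤ) : ℝ) := by
    have : 0 ≤ max |k₂| |k₃| := le_max_of_le_left (abs_nonneg _)
    exact_mod_cast this
  have hab : jb a * jb b ≤ 4 * c₃ * (jb k₂ * jb k₃) ^ (1 / 100 : ℝ) := by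
    calc jb a * jb b ≤ (2 * |(a : ℝ)|) * (2 * |(b : ℝ)|) :=
          mul_le_mul (jb_le_two_mul_abs_s18 ha) (jb_le_two_mul_abs_s18 hb) (jb_pos _).le (by positivity)
      _ = 4 * ((|a| * |b| : ℤ) : ℝ) := by push_cast; ring
      _ ≤ 4 * (c₃ * ((max |k₂| |k₃| : ℤ) : ℝ) ^ (1 / 100 : ℝ)) := by gcongr
      _ ≤ 4 * (c₃ * (jb k₂ * jb k₃) ^ (1 / 100 : ℝ)) := by gcongr
      _ = _ := by ring
  have hsq : (jb a * jb b) ^ 2 ≤ (4 * c₃) ^ 2 * (jb k₂ * jb k₃) ^ (1 / 50 : ℝ) := by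
    calc _ ≤ (4 * c₃ * (jb k₂ * jb k₃) ^ (1 / 100 : ℝ)) ^ 2 := by
          have := jb_pos a
          have := jb_pos b
          gcongr
      _ = _ := by
        rw [mul_pow, ← Real.rpow_natCast ((jb k₂ * jb k₃) ^ (1 / 100 : ℝ)),
          ← Real.rpow_mul hP0.le]
        norm_num
  have ha0 := jb_pos a
  have hb0 := jb_pos b
  rw [Real.rpow_neg ha0.le, Real.rpow_neg hb0.le, Real.rpow_two, Real.rpow_two,
    ← mul_inv, ← mul_pow, ← div_eq_mul_inv, one_le_div (by positivity)]
  exact hsq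

/-- Pointwise bound of the summand by weights on the pair sums and on `k₂`, `k₃`. -/
theorem term18_le {c₁ c₂ c₃ : ℝ} (hc₁ : 0 < c₁) (hc₂ : 0 < c₂) (hc₃ : 0 < c₃) {u z : ℤ → ℝ}
    (hu : ∀ k, 0 ≤ u k) (hz : ∀ k, 0 ≤ z k) (j₁ j₂ j₃ k₂ k₃ : ℤ) :
    term18 c₁ c₂ c₃ u z j₁ j₂ j₃ k₂ k₃ ≤ 48 / (c₁ * (c₂ ^ (1 / 2 : ℝ)) ^ 3) * (4 * c₃) ^ 2 *
      ((jb (j₁ + j₂) ^ (-2 : ℝ) * jb (j₂ + j₃) ^ (-2 : ℝ) +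
        jb (j₂ + j₃) ^ (-2 : ℝ) * jb (j₃ + j₁) ^ (-2 : ℝ) +
        jb (j₃ + j₁) ^ (-2 : ℝ) * jb (j₁ + j₂) ^ (-2 : ℝ)) *
        (u j₁ * u j₂ * u j₃ * z (j₁ + j₂ + j₃ + (k₂ + k₃))) *
        (jb k₂ ^ (-(3 / 5) : ℝ) * u k₂ * (jb k₃ ^ (-(3 / 5) : ℝ) * u k₃))) := by
  have hnn (p : ℝ) (k : ℤ) : 0 ≤ jb k ^ p := Real.rpow_nonneg (jb_pos k).le p
  have hu₁ := hu j₁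
  have hu₂ := hu j₂
  have hu₃ := hu j₃
  have hu₄ := hu k₂
  have hu₅ := hu k₃
  have hz₀ := hz (j₁ + j₂ + j₃ + (k₂ + k₃))
  have hv₂ := hnn (-(3 / 5)) k₂
  have hv₃ := hnn (-(3 / 5)) k₃
  have h₁₂ := hnn (-2) (j₁ + j₂)
  have h₂₃ := hnn (-2) (j₂ + j₃)
  have h₃₁ := hnn (-2) (j₃ + j₁)
  unfold term18
  dsimp only
  split_ifs with h
  · obtain ⟨hk, hj, hPhi, hcomp, hLam⟩ := h
    obtain ⟨hj12, hj23, hj31⟩ := pair_sums_ne_zero hj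
    set E : ℝ := jb (j₁ + j₂) ^ (-2 : ℝ) * jb (j₂ + j₃) ^ (-2 : ℝ) +
        jb (j₂ + j₃) ^ (-2 : ℝ) * jb (j₃ + j₁) ^ (-2 : ℝ) +
        jb (j₃ + j₁) ^ (-2 : ℝ) * jb (j₁ + j₂) ^ (-2 : ℝ) with hE
    have hP0 : 0 < jb k₂ * jb k₃ := mul_pos (jb_pos _) (jb_pos _)
    have hP1 : 1 ≤ jb k₂ * jb k₃ := one_le_mul_of_one_le_of_one_le (one_le_jb _) (one_le_jb _)
    have hone : 1 ≤ (4 * c₃) ^ 2 * (jb k₂ * jb k₃) ^ (1 / 50 : ℝ) * E := by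
      have key {a b : ℤ} (ha : a ≠ 0) (hb : b ≠ 0) (hab : Lam j₁ j₂ j₃ = |a| * |b|)
          (hle : jb a ^ (-2 : ℝ) * jb b ^ (-2 : ℝ) ≤ E) :
          1 ≤ (4 * c₃) ^ 2 * (jb k₂ * jb k₃) ^ (1 / 50 : ℝ) * E :=
        (one_le_weight hc₃ ha hb (hab ▸ hLam)).trans (by gcongr)
      have m₁ := mul_nonneg h₁₂ h₂₃
      have m₂ := mul_nonneg h₂₃ h₃₁
      have m₃ := mul_nonneg h₃₁ h₁₂
      have hcases : Lam j₁ j₂ j₃ = |j₁ + j₂| * |j₂ + j₃| ∨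
          Lam j₁ j₂ j₃ = |j₂ + j₃| * |j₃ + j₁| ∨ Lam j₁ j₂ j₃ = |j₃ + j₁| * |j₁ + j₂| := by
        unfold Lam; grind
      rcases hcases with h | h | h
      · exact key hj12 hj23 h (by linarith)
      · exact key hj23 hj31 h (by linarith)
      · exact key hj31 hj12 h (by linarith)
    have hE0 : 0 ≤ E := by positivity
    have hM : M2 (1 / 2) j₁ j₂ j₃ k₂ k₃ ≤ 48 / (c₁ * (c₂ ^ (1 / 2 : ℝ)) ^ 3) * (4 * c₃) ^ 2 *
        (E * (jb k₂ ^ (-(3 / 5) : ℝ) * jb k₃ ^ (-(3 / 5) : ℝ))) := by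
      calc M2 (1 / 2) j₁ j₂ j₃ k₂ k₃
          ≤ 48 / (c₁ * (c₂ ^ (1 / 2 : ℝ)) ^ 3) * (jb k₂ * jb k₃) ^ (-(3 / 4) : ℝ) * 1 := by
            rw [mul_one]; exact M2_le_s18 hc₁ hc₂ hk hj hPhi hcomp
        _ ≤ 48 / (c₁ * (c₂ ^ (1 / 2 : ℝ)) ^ 3) * (jb k₂ * jb k₃) ^ (-(3 / 4) : ℝ) *
            ((4 * c₃) ^ 2 * (jb k₂ * jb k₃) ^ (1 / 50 : ℝ) * E) := by gcongr
        _ = 48 / (c₁ * (c₂ ^ (1 / 2 : ℝ)) ^ 3) * (4 * c₃) ^ 2 *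
            (E * (jb k₂ * jb k₃) ^ (-(3 / 4) + 1 / 50 : ℝ)) := by
          rw [Real.rpow_add hP0]; ring
        _ ≤ 48 / (c₁ * (c₂ ^ (1 / 2 : ℝ)) ^ 3) * (4 * c₃) ^ 2 *
            (E * (jb k₂ * jb k₃) ^ (-(3 / 5) : ℝ)) := by
          gcongr
          norm_num
        _ = _ := by rw [Real.mul_rpow (jb_pos _).le (jb_pos _).le]
    rw [show j₁ + j₂ + j₃ + k₂ + k₃ = j₁ + j₂ + j₃ + (k₂ + k₃) by ring]
    calc _ ≤ _ := mul_le_mul_of_nonneg_right hM (by positivity)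
      _ = _ := by ring
  · positivity

theorem ofReal_term18_le {c₁ c₂ c₃ : ℝ} (hc₁ : 0 < c₁) (hc₂ : 0 < c₂) (hc₃ : 0 < c₃)
    {u z : ℤ → ℝ} (hu : ∀ k, 0 ≤ u k) (hz : ∀ k, 0 ≤ z k) (j₁ j₂ j₃ k₂ k₃ : ℤ) :
    ENNReal.ofReal (term18 c₁ c₂ c₃ u z j₁ j₂ j₃ k₂ k₃) ≤
      ENNReal.ofReal (48 / (c₁ * (c₂ ^ (1 / 2 : ℝ)) ^ 3) * (4 * c₃) ^ 2) *
      ((ENNReal.ofReal (jb (j₁ + j₂) ^ (-2 : ℝ)) * ENNReal.ofReal (jb (j₂ + j₃) ^ (-2 : ℝ)) +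
        ENNReal.ofReal (jb (j₂ + j₃) ^ (-2 : ℝ)) * ENNReal.ofReal (jb (j₃ + j₁) ^ (-2 : ℝ)) +
        ENNReal.ofReal (jb (j₃ + j₁) ^ (-2 : ℝ)) * ENNReal.ofReal (jb (j₁ + j₂) ^ (-2 : ℝ))) *
        (ENNReal.ofReal (u j₁) * ENNReal.ofReal (u j₂) * ENNReal.ofReal (u j₃) *
          ENNReal.ofReal (z (j₁ + j₂ + j₃ + (k₂ + k₃)))) *
        (ENNReal.ofReal (jb k₂ ^ (-(3 / 5) : ℝ)) * ENNReal.ofReal (u k₂) *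
          (ENNReal.ofReal (jb k₃ ^ (-(3 / 5) : ℝ)) * ENNReal.ofReal (u k₃)))) := by
  have hnn (p : ℝ) (k : ℤ) : 0 ≤ jb k ^ p := Real.rpow_nonneg (jb_pos k).le p
  have h₁₂ := hnn (-2) (j₁ + j₂)
  have h₂₃ := hnn (-2) (j₂ + j₃)
  have h₃₁ := hnn (-2) (j₃ + j₁)
  have hv₂ := hnn (-(3 / 5)) k₂
  have hu₁ := hu j₁
  have hu₂ := hu j₂
  have hu₃ := hu j₃
  have hu₄ := hu k₂
  have hz₀ := hz (j₁ + j₂ + j₃ + (k₂ + k₃))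
  have hv₃ := hnn (-(3 / 5)) k₃
  refine (ENNReal.ofReal_le_ofReal (term18_le hc₁ hc₂ hc₃ hu hz j₁ j₂ j₃ k₂ k₃)).trans_eq ?_
  generalize hA : 48 / (c₁ * (c₂ ^ (1 / 2 : ℝ)) ^ 3) * (4 * c₃) ^ 2 = A
  have hA0 : 0 ≤ A := hA ▸ by positivity
  rw [ENNReal.ofReal_mul hA0, ENNReal.ofReal_mul (by positivity),
    ENNReal.ofReal_mul (by positivity), ENNReal.ofReal_add (by positivity) (by positivity),
    ENNReal.ofReal_add (by positivity) (by positivity), ENNReal.ofReal_mul h₁₂,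
    ENNReal.ofReal_mul h₂₃, ENNReal.ofReal_mul h₃₁, ENNReal.ofReal_mul (by positivity),
    ENNReal.ofReal_mul (by positivity), ENNReal.ofReal_mul (by positivity),
    ENNReal.ofReal_mul (by positivity), ENNReal.ofReal_mul hv₂, ENNReal.ofReal_mul hv₃]

theorem tsum_quintuple_comm (F : ℤ → ℤ → ℤ → ℤ → ℤ → ℝ≥0∞) :
    ∑' q : ℤ × ℤ × ℤ × ℤ × ℤ, F q.1 q.2.1 q.2.2.1 q.2.2.2.1 q.2.2.2.2 =
      ∑' (k₂ : ℤ) (k₃ : ℤ) (j₁ : ℤ) (j₂ : ℤ) (j₃ : ℤ), F j₁ j₂ j₃ k₂ k₃ := by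
  let e : (ℤ × ℤ) × ℤ × ℤ × ℤ ≃ ℤ × ℤ × ℤ × ℤ × ℤ :=
    { toFun := fun p => (p.2.1, p.2.2.1, p.2.2.2, p.1.1, p.1.2)
      invFun := fun q => ((q.2.2.2.1, q.2.2.2.2), q.1, q.2.1, q.2.2.1)
      left_inv := fun _ => rfl
      right_inv := fun _ => rfl }
  rw [← e.tsum_eq]
  simp only [ENNReal.tsum_prod', e, Equiv.coe_fn_mk]

/-- The cubic bound, symmetrised over the cyclic permutations of the triple. -/
theorem tsum_triple_cyclic_le {w U Z : ℤ → ℝ≥0∞} {m : ℤ} {R : ℝ≥0∞}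
    (h : ∑' (x : ℤ) (y : ℤ) (t : ℤ),
      w (x + y) * w (y + t) * (U x * U y * U t * Z (x + y + t + m)) ≤ R) :
    ∑' (x : ℤ) (y : ℤ) (t : ℤ),
      (w (x + y) * w (y + t) + w (y + t) * w (t + x) + w (t + x) * w (x + y)) *
        (U x * U y * U t * Z (x + y + t + m)) ≤ 3 * R := by
  set G : ℤ → ℤ → ℤ → ℝ≥0∞ := fun x y t =>
    w (x + y) * w (y + t) * (U x * U y * U t * Z (x + y + t + m)) with hG
  have hsplit (x y t : ℤ) :
      (w (x + y) * w (y + t) + w (y + t) * w (t + x) + w (t + x) * w (x + y)) *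
        (U x * U y * U t * Z (x + y + t + m)) = G x y t + G y t x + G t x y := by
    simp only [hG]
    rw [show y + t + x + m = x + y + t + m by ring, show t + x + y + m = x + y + t + m by ring]
    ring
  have h₁ : ∑' (x : ℤ) (y : ℤ) (t : ℤ), G y t x = ∑' (x : ℤ) (y : ℤ) (t : ℤ), G x y t := by
    rw [ENNReal.tsum_comm]
    congr 1; ext y
    exact ENNReal.tsum_comm
  have h₂ : ∑' (x : ℤ) (y : ℤ) (t : ℤ), G t x y = ∑' (x : ℤ) (y : ℤ) (t : ℤ), G x y t := by
    calc _ = ∑' (x : ℤ) (t : ℤ) (y : ℤ), G t x y := by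
          congr 1; ext x
          exact ENNReal.tsum_comm
      _ = _ := ENNReal.tsum_comm
  simp_rw [hsplit, ENNReal.tsum_add]
  rw [h₁, h₂]
  calc _ ≤ R + R + R := by gcongr
    _ = 3 * R := by ring

/-- Restricted quintic `M₂` estimate at `s = 1/2`, case (d). -/
theorem M2_restricted_d (c₁ c₂ c₃ : ℝ) (hc₁ : 0 < c₁) (hc₂ : 0 < c₂) (hc₃ : 0 < c₃) :
    ∃ C > (0 : ℝ), ∀ u z : ℤ → ℝ, (∀ k, 0 ≤ u k) → (∀ k, 0 ≤ z k) →
      l2 u < ⊤ → l2 z < ⊤ →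
      (∑' q : ℤ × ℤ × ℤ × ℤ × ℤ,
        ENNReal.ofReal (term18 c₁ c₂ c₃ u z q.1 q.2.1 q.2.2.1 q.2.2.2.1 q.2.2.2.2)) ≤
        ENNReal.ofReal C * l2 u ^ 5 * l2 z := by
  set w : ℤ → ℝ≥0∞ := fun k => ENNReal.ofReal (jb k ^ (-2 : ℝ)) with hw
  set v : ℤ → ℝ≥0∞ := fun k => ENNReal.ofReal (jb k ^ (-(3 / 5) : ℝ)) with hv
  set W : ℝ≥0∞ := ∑' k, w k with hW
  set V : ℝ≥0∞ := (∑' k, v k ^ 2) ^ (1 / 2 : ℝ) with hV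
  set A : ℝ := 48 / (c₁ * (c₂ ^ (1 / 2 : ℝ)) ^ 3) * (4 * c₃) ^ 2 with hA
  have hW_top : W ≠ ⊤ := (summable_jb_rpow (by norm_num)).tsum_ofReal_ne_top
  have hV_top : V ≠ ⊤ := by
    refine ENNReal.rpow_ne_top_of_nonneg (by norm_num) ?_
    have : ∀ k, v k ^ 2 = ENNReal.ofReal (jb k ^ (-(6 / 5) : ℝ)) := fun k => by
      simp only [hv]
      rw [← ENNReal.ofReal_pow (Real.rpow_nonneg (jb_pos k).le _), ← Real.rpow_natCast,
        ← Real.rpow_mul (jb_pos k).le]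
      norm_num
    simp_rw [this]
    exact (summable_jb_rpow (by norm_num)).tsum_ofReal_ne_top
  set B : ℝ≥0∞ := ENNReal.ofReal A * (3 * (W ^ 2 * V ^ 2)) with hB
  have hB_top : B ≠ ⊤ := by finiteness
  refine ⟨B.toReal + 1, by positivity, fun u z hu hz _ _ => ?_⟩
  set U : ℤ → ℝ≥0∞ := fun k => ENNReal.ofReal (u k) with hU
  set Z : ℤ → ℝ≥0∞ := fun k => ENNReal.ofReal (z k) with hZ
  have hU2 : (∑' i, U i ^ 2) ^ (1 / 2 : ℝ) = l2 u := by
    simp only [l2, hU, ENNReal.ofReal_pow (hu _)]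
  have hZ2 : (∑' i, Z i ^ 2) ^ (1 / 2 : ℝ) = l2 z := by
    simp only [l2, hZ, ENNReal.ofReal_pow (hz _)]
  have hpt (j₁ j₂ j₃ k₂ k₃ : ℤ) := ofReal_term18_le hc₁ hc₂ hc₃ hu hz j₁ j₂ j₃ k₂ k₃
  have hcubic (m : ℤ) := tsum_triple_le w U Z m
  rw [hU2, hZ2] at hcubic
  calc _ ≤ ∑' q : ℤ × ℤ × ℤ × ℤ × ℤ, ENNReal.ofReal A *
        ((w (q.1 + q.2.1) * w (q.2.1 + q.2.2.1) + w (q.2.1 + q.2.2.1) * w (q.2.2.1 + q.1) +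
            w (q.2.2.1 + q.1) * w (q.1 + q.2.1)) *
          (U q.1 * U q.2.1 * U q.2.2.1 * Z (q.1 + q.2.1 + q.2.2.1 + (q.2.2.2.1 + q.2.2.2.2))) *
          (v q.2.2.2.1 * U q.2.2.2.1 * (v q.2.2.2.2 * U q.2.2.2.2))) :=
        ENNReal.tsum_le_tsum fun q => hpt _ _ _ _ _
    _ = ENNReal.ofReal A * ∑' (k₂ : ℤ) (k₃ : ℤ), (∑' (j₁ : ℤ) (j₂ : ℤ) (j₃ : ℤ),
        (w (j₁ + j₂) * w (j₂ + j₃) + w (j₂ + j₃) * w (j₃ + j₁) + w (j₃ + j₁) * w (j₁ + j₂)) *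
          (U j₁ * U j₂ * U j₃ * Z (j₁ + j₂ + j₃ + (k₂ + k₃)))) *
          (v k₂ * U k₂ * (v k₃ * U k₃)) := by
        rw [ENNReal.tsum_mul_left]
        congr 1
        refine (tsum_quintuple_comm fun j₁ j₂ j₃ k₂ k₃ =>
          (w (j₁ + j₂) * w (j₂ + j₃) + w (j₂ + j₃) * w (j₃ + j₁) + w (j₃ + j₁) * w (j₁ + j₂)) *
            (U j₁ * U j₂ * U j₃ * Z (j₁ + j₂ + j₃ + (k₂ + k₃))) *
            (v k₂ * U k₂ * (v k₃ * U k₃))).trans ?_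
        simp_rw [ENNReal.tsum_mul_right]
    _ ≤ ENNReal.ofReal A * ∑' (k₂ : ℤ) (k₃ : ℤ), (3 * (W ^ 2 * l2 u ^ 3 * l2 z)) *
          (v k₂ * U k₂ * (v k₃ * U k₃)) := by
        gcongr with k₂ k₃
        exact tsum_triple_cyclic_le (hcubic (k₂ + k₃))
    _ = ENNReal.ofReal A * ((3 * (W ^ 2 * l2 u ^ 3 * l2 z)) * (∑' k, v k * U k) ^ 2) := by
        simp_rw [ENNReal.tsum_mul_left, ENNReal.tsum_mul_right, sq]
    _ ≤ ENNReal.ofReal A * ((3 * (W ^ 2 * l2 u ^ 3 * l2 z)) * (V * l2 u) ^ 2) := by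
        gcongr
        exact (tsum_mul_le_l2 v U).trans_eq (by rw [hU2])
    _ = B * l2 u ^ 5 * l2 z := by rw [hB]; ring
    _ ≤ ENNReal.ofReal (B.toReal + 1) * l2 u ^ 5 * l2 z := by
        gcongr
        exact (ENNReal.ofReal_toReal hB_top).symm.le.trans
          (ENNReal.ofReal_le_ofReal (by linarith))
end
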